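/- arXiv:2209.11882 — 3 statements merged into one kernel-verified Lean document; each statement's English description precedes it below -/
import Mathlib

section
/- For every integer k ≥ 2 there exists a constant c > 0 (depending only on k) such that for all integers n ≥ k, the maximum size D(n,k) of a k-deletion code of length n satisfies D(n,k) ≥ c · 2^n · log₂(n) / n^(2k). -/
/-- Length of a longest common subsequence of two binary words. -/
noncomputable def LCSlen (u v : List Bool) : ℕ :=
  sSup {m : ℕ | ∃ w : List Bool, w.Sublist u ∧ w.Sublist v ∧ w.length = m}

/-- Length of a shortest common supersequence of two binary words. -/
noncomputable def SCSlen (u v : List Bool) : ℕ :=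
  sInf {m : ℕ | ∃ w : List Bool, u.Sublist w ∧ v.Sublist w ∧ w.length = m}

/-- Deletion distance between two words of equal length `n`: `n - LCS`. -/
noncomputable def delDist (u v : List Bool) : ℕ := u.length - LCSlen u v

/-- Number of distinct longest common subsequences. -/
noncomputable def mLCS (u v : List Bool) : ℕ :=
  Set.ncard {w : List Bool | w.Sublist u ∧ w.Sublist v ∧ w.length = LCSlen u v}

/-- Number of distinct shortest common supersequences. -/
noncomputable def mSCS (u v : List Bool) : ℕ :=
  Set.ncard {w : List Bool | u.Sublist w ∧ v.Sublist w ∧ w.length = SCSlen u v}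

section HardCore

open Finset Classical

variable {α : Type*}

/-- The independent subsets of the finite set `X` with respect to the relation `r`. -/
noncomputable def indepSets (r : α → α → Prop) (X : Finset α) : Finset (Finset α) :=
  X.powerset.filter fun I => ∀ a ∈ I, ∀ b ∈ I, ¬ r a b

/-- The hard-core partition function on `X` at fugacity `t`. -/
noncomputable def hardCoreSum (r : α → α → Prop) (t : ℝ) (X : Finset α) : ℝ :=
  ∑ I ∈ indepSets r X, t ^ #I

variable {r : α → α → Prop} {t : ℝ}

lemma mem_indepSets {X I : Finset α} :
    I ∈ indepSets r X ↔ I ⊆ X ∧ ∀ a ∈ I, ∀ b ∈ I, ¬ r a b := by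
  simp [indepSets]

lemma one_le_hardCoreSum (ht : 0 ≤ t) (X : Finset α) : 1 ≤ hardCoreSum r t X := by
  have h : (∅ : Finset α) ∈ indepSets r X := by simp [mem_indepSets]
  have := single_le_sum (f := fun I : Finset α => t ^ #I) (fun I _ => pow_nonneg ht _) h
  simpa [hardCoreSum] using this

lemma hardCoreSum_insert_le (ht : 0 ≤ t) {X : Finset α} {a : α} (ha : a ∉ X) :
    hardCoreSum r t (insert a X) ≤ (1 + t) * hardCoreSum r t X := by
  have hsub : indepSets r (insert a X) ⊆
      indepSets r X ∪ (indepSets r X).image (insert a) := by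
    intro I hI
    rw [mem_indepSets] at hI
    by_cases haI : a ∈ I
    · refine mem_union_right _ (mem_image.2 ⟨I.erase a, ?_, insert_erase haI⟩)
      rw [mem_indepSets]
      refine ⟨fun x hx => ?_, fun x hx y hy =>
        hI.2 x (mem_of_mem_erase hx) y (mem_of_mem_erase hy)⟩
      exact (mem_insert.1 (hI.1 (mem_of_mem_erase hx))).resolve_left (ne_of_mem_erase hx)
    · refine mem_union_left _ (mem_indepSets.2 ⟨fun x hx => ?_, hI.2⟩)
      exact (mem_insert.1 (hI.1 hx)).resolve_left (fun h => haI (h ▸ hx))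
  have hnot : ∀ I ∈ indepSets r X, a ∉ I := fun I hI h => ha ((mem_indepSets.1 hI).1 h)
  have hinj : Set.InjOn (insert a) (indepSets r X : Set (Finset α)) := by
    intro I hI J hJ h
    rw [← erase_insert (hnot I hI), ← erase_insert (hnot J hJ), h]
  calc hardCoreSum r t (insert a X)
      ≤ ∑ I ∈ indepSets r X ∪ (indepSets r X).image (insert a), t ^ #I :=
        sum_le_sum_of_subset_of_nonneg hsub fun _ _ _ => pow_nonneg ht _
    _ ≤ ∑ I ∈ indepSets r X, t ^ #I + ∑ I ∈ (indepSets r X).image (insert a), t ^ #I := by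
        rw [← sum_union_inter]
        exact le_add_of_nonneg_right (sum_nonneg fun _ _ => pow_nonneg ht _)
    _ = (1 + t) * hardCoreSum r t X := by
        rw [sum_image hinj, hardCoreSum, add_mul, one_mul, mul_sum]
        congr 1
        refine sum_congr rfl fun I hI => ?_
        rw [card_insert_of_notMem (hnot I hI), pow_succ']

lemma hardCoreSum_union_le (ht : 0 ≤ t) (Y W : Finset α) :
    hardCoreSum r t (Y ∪ W) ≤ (1 + t) ^ #W * hardCoreSum r t Y := by
  induction W using Finset.induction_on with
  | empty => simp
  | insert a W ha ih =>
    rw [union_insert, card_insert_of_notMem ha]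
    have h1 : 0 ≤ hardCoreSum r t (Y ∪ W) :=
      zero_le_one.trans (one_le_hardCoreSum ht _)
    by_cases h : a ∈ Y ∪ W
    · rw [insert_eq_of_mem h, pow_succ']
      nlinarith
    · refine (hardCoreSum_insert_le ht h).trans ?_
      rw [pow_succ', mul_assoc]
      gcongr

lemma hardCoreSum_le_pow (ht : 0 ≤ t) (X : Finset α) :
    hardCoreSum r t X ≤ (1 + t) ^ #X := by
  have h := hardCoreSum_union_le (r := r) ht ∅ X
  simpa [hardCoreSum, indepSets, filter_singleton] using h

lemma one_add_pow_mul_le (ht : 0 ≤ t) (m : ℕ) : (1 + t) ^ m * (1 - t * m) ≤ 1 := by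
  have h1 : (1 + t) ^ m ≤ Real.exp (t * m) := by
    rw [mul_comm, Real.exp_nat_mul]
    gcongr
    linarith [Real.add_one_le_exp t]
  have h2 : 1 - t * m ≤ Real.exp (-(t * m)) := by
    linarith [Real.add_one_le_exp (-(t * m))]
  calc (1 + t) ^ m * (1 - t * m) ≤ (1 + t) ^ m * Real.exp (-(t * m)) := by gcongr
    _ ≤ Real.exp (t * m) * Real.exp (-(t * m)) := by gcongr
    _ = 1 := by rw [← Real.exp_add]; simp

/-- The contribution of the independent sets through a given vertex. -/
lemma le_sum_indepSets_mem (ht : 0 ≤ t) (hsymm : ∀ a b, r a b → r b a) (hirr : ∀ a, ¬ r a a)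
    {X : Finset α} {a : α} (ha : a ∈ X) :
    t * (hardCoreSum r t X * (1 - t * (#(X.filter (r a)) + 1 : ℕ))) ≤
      ∑ I ∈ (indepSets r X).filter (a ∈ ·), t ^ #I := by
  set W := insert a (X.filter (r a)) with hW
  have hWc : #W = #(X.filter (r a)) + 1 := card_insert_of_notMem (by simp [hirr])
  have hWX : W ⊆ X := by
    rw [hW, insert_subset_iff]; exact ⟨ha, filter_subset _ _⟩
  have hZ : hardCoreSum r t X ≤ (1 + t) ^ #W * hardCoreSum r t (X \ W) := by
    have := hardCoreSum_union_le (r := r) ht (X \ W) W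
    rwa [sdiff_union_of_subset hWX] at this
  have hpos : 0 ≤ hardCoreSum r t (X \ W) := zero_le_one.trans (one_le_hardCoreSum ht _)
  have hnot : ∀ I ∈ indepSets r (X \ W), a ∉ I := fun I hI h => by
    have := (mem_indepSets.1 hI).1 h
    simp [hW] at this
  have hinj : Set.InjOn (insert a) (indepSets r (X \ W) : Set (Finset α)) := by
    intro I hI J hJ h
    rw [← erase_insert (hnot I hI), ← erase_insert (hnot J hJ), h]
  have hsub : (indepSets r (X \ W)).image (insert a) ⊆ (indepSets r X).filter (a ∈ ·) := by
    intro J hJ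
    obtain ⟨I, hI, rfl⟩ := mem_image.1 hJ
    have hI' := mem_indepSets.1 hI
    have hna : ∀ x ∈ I, ¬ r a x := fun x hx hr => by
      have := mem_sdiff.1 (hI'.1 hx)
      exact this.2 (by simp [hW, hr, this.1])
    simp only [mem_filter, mem_indepSets, mem_insert_self, and_true, insert_subset_iff]
    refine ⟨⟨ha, hI'.1.trans sdiff_subset⟩, fun x hx y hy => ?_⟩
    rcases mem_insert.1 hx with rfl | hxI <;> rcases mem_insert.1 hy with rfl | hyI
    · exact hirr _
    · exact hna y hyI
    · exact fun h => hna x hxI (hsymm _ _ h)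
    · exact hI'.2 x hxI y hyI
  calc t * (hardCoreSum r t X * (1 - t * (#(X.filter (r a)) + 1 : ℕ)))
      ≤ t * hardCoreSum r t (X \ W) := by
        refine mul_le_mul_of_nonneg_left ?_ ht
        rw [← hWc]
        rcases le_total 0 (1 - t * (#W : ℝ)) with h | h
        · calc _ ≤ ((1 + t) ^ #W * hardCoreSum r t (X \ W)) * (1 - t * (#W : ℝ)) := by gcongr
            _ = ((1 + t) ^ #W * (1 - t * (#W : ℝ))) * hardCoreSum r t (X \ W) := by ring
            _ ≤ 1 * hardCoreSum r t (X \ W) := by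
                gcongr; exact one_add_pow_mul_le ht _
            _ = _ := one_mul _
        · exact (mul_nonpos_of_nonneg_of_nonpos
            (zero_le_one.trans (one_le_hardCoreSum ht _)) h).trans hpos
    _ = ∑ J ∈ (indepSets r (X \ W)).image (insert a), t ^ #J := by
        rw [sum_image hinj, hardCoreSum, mul_sum]
        refine sum_congr rfl fun I hI => ?_
        rw [card_insert_of_notMem (hnot I hI), pow_succ']
    _ ≤ _ := sum_le_sum_of_subset_of_nonneg hsub fun _ _ _ => pow_nonneg ht _

/-- A lower bound for the mean size of a hard-core random independent set. -/
lemma le_sum_card_mul_pow (ht : 0 ≤ t) (hsymm : ∀ a b, r a b → r b a) (hirr : ∀ a, ¬ r a a)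
    (X : Finset α) :
    hardCoreSum r t X * (t * #X * (1 - t) - t ^ 2 * ∑ a ∈ X, (#(X.filter (r a)) : ℝ)) ≤
      ∑ I ∈ indepSets r X, (#I : ℝ) * t ^ #I := by
  have h1 : ∑ I ∈ indepSets r X, (#I : ℝ) * t ^ #I =
      ∑ a ∈ X, ∑ I ∈ (indepSets r X).filter (a ∈ ·), t ^ #I := by
    simp_rw [sum_filter]
    rw [sum_comm]
    refine sum_congr rfl fun I hI => ?_
    rw [← sum_filter, sum_const, nsmul_eq_mul, filter_mem_eq_inter,
      inter_eq_right.2 (mem_indepSets.1 hI).1]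
  rw [h1]
  refine le_trans (le_of_eq ?_) (sum_le_sum fun a ha => le_sum_indepSets_mem ht hsymm hirr ha)
  have h2 : ∀ a ∈ X, t * (hardCoreSum r t X * (1 - t * (#(X.filter (r a)) + 1 : ℕ))) =
      hardCoreSum r t X * (t * (1 - t)) - hardCoreSum r t X * t ^ 2 * (#(X.filter (r a)) : ℝ) := by
    intro a _
    push_cast
    ring
  rw [sum_congr rfl h2, sum_sub_distrib, sum_const, nsmul_eq_mul, ← mul_sum]
  ring

/-- Summation over the independent sets that restrict to `J` outside the closed neighbourhood
of `v`. -/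
lemma sum_indepSets_fiber (hsymm : ∀ a b, r a b → r b a) (hirr : ∀ a, ¬ r a a)
    {V J : Finset α} {v : α} (hv : v ∈ V) (hJ : J ∈ indepSets r V)
    (hJv : Disjoint J (insert v (V.filter (r v)))) (g : Finset α → ℝ) :
    ∑ W ∈ (indepSets r V).filter (· \ insert v (V.filter (r v)) = J), g W =
      g (insert v J) +
        ∑ I ∈ indepSets r ((V.filter (r v)).filter fun u => ∀ b ∈ J, ¬ r u b), g (J ∪ I) := by
  have hJ' := mem_indepSets.1 hJ
  have hJn : ∀ x ∈ J, x ≠ v ∧ ¬ r v x := by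
    intro x hx
    have := disjoint_left.1 hJv hx
    simp only [mem_insert, mem_filter, not_or, not_and] at this
    exact ⟨this.1, this.2 (hJ'.1 hx)⟩
  rw [← sum_filter_add_sum_filter_not _ (v ∈ ·)]
  congr 1
  · have : ((indepSets r V).filter (· \ insert v (V.filter (r v)) = J)).filter (v ∈ ·) =
        {insert v J} := by
      ext W
      simp only [mem_filter, mem_singleton, mem_indepSets]
      constructor
      · rintro ⟨⟨⟨hWV, hW⟩, rfl⟩, hvW⟩
        ext x
        simp only [mem_insert, mem_sdiff, mem_filter, not_or, not_and]
        constructor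
        · intro hx
          by_cases hxv : x = v
          · exact Or.inl hxv
          · exact Or.inr ⟨hx, hxv, fun _ => hW v hvW x hx⟩
        · rintro (rfl | h)
          · exact hvW
          · exact h.1
      · rintro rfl
        refine ⟨⟨⟨insert_subset hv hJ'.1, fun x hx y hy => ?_⟩, ?_⟩, mem_insert_self _ _⟩
        · rcases mem_insert.1 hx with rfl | hxJ <;> rcases mem_insert.1 hy with rfl | hyJ
          · exact hirr _
          · exact (hJn y hyJ).2
          · exact fun h => (hJn x hxJ).2 (hsymm _ _ h)
          · exact hJ'.2 x hxJ y hyJ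
        · ext x
          simp only [mem_insert, mem_sdiff, mem_filter, not_or, not_and]
          constructor
          · rintro ⟨h1 | h1, h2, -⟩
            · exact absurd h1 h2
            · exact h1
          · intro hx
            exact ⟨Or.inr hx, (hJn x hx).1, fun _ => (hJn x hx).2⟩
    rw [this, sum_singleton]
  · refine sum_nbij' (fun W => W ∩ V.filter (r v)) (fun I => J ∪ I) ?_ ?_ ?_ ?_ ?_
    · intro W hW
      simp only [mem_filter, mem_indepSets] at hW ⊢
      obtain ⟨⟨⟨hWV, hW⟩, rfl⟩, hvW⟩ := hW
      refine ⟨fun x hx => ?_, fun x hx y hy => hW x (mem_inter.1 hx).1 y (mem_inter.1 hy).1⟩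
      rw [mem_filter]
      exact ⟨(mem_inter.1 hx).2, fun b hb => hW x (mem_inter.1 hx).1 b (mem_sdiff.1 hb).1⟩
    · intro I hI
      simp only [mem_filter, mem_indepSets] at hI ⊢
      have hI1 : ∀ x ∈ I, (x ∈ V ∧ r v x) ∧ ∀ b ∈ J, ¬ r x b := fun x hx => by
        simpa using hI.1 hx
      refine ⟨⟨⟨union_subset hJ'.1 fun x hx => (hI1 x hx).1.1, fun x hx y hy => ?_⟩, ?_⟩, ?_⟩
      · rcases mem_union.1 hx with hx | hx <;> rcases mem_union.1 hy with hy | hy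
        · exact hJ'.2 x hx y hy
        · exact fun h => (hI1 y hy).2 x hx (hsymm _ _ h)
        · exact (hI1 x hx).2 y hy
        · exact hI.2 x hx y hy
      · ext x
        simp only [mem_insert, mem_sdiff, mem_filter, mem_union, not_or, not_and]
        constructor
        · rintro ⟨h1 | h1, -, h3⟩
          · exact h1
          · exact absurd (hI1 x h1).1.2 (h3 (hI1 x h1).1.1)
        · intro hx
          exact ⟨Or.inl hx, (hJn x hx).1, fun _ => (hJn x hx).2⟩
      · intro h
        rcases mem_union.1 h with h | h
        · exact (hJn v h).1 rfl
        · exact hirr v (hI1 v h).1.2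
    · intro W hW
      simp only [mem_filter, mem_indepSets] at hW
      obtain ⟨⟨⟨hWV, hW⟩, rfl⟩, hvW⟩ := hW
      ext x
      simp only [mem_insert, mem_sdiff, mem_filter, mem_union, mem_inter, not_or, not_and]
      constructor
      · rintro (h | h)
        · exact h.1
        · exact h.1
      · intro hx
        by_cases hr : r v x
        · exact Or.inr ⟨hx, hWV hx, hr⟩
        · exact Or.inl ⟨hx, fun h => hvW (h ▸ hx), fun _ => hr⟩
    · intro I hI
      simp only [mem_indepSets] at hI
      have hI1 : ∀ x ∈ I, (x ∈ V ∧ r v x) ∧ ∀ b ∈ J, ¬ r x b := fun x hx => by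
        simpa using hI.1 hx
      ext x
      simp only [mem_filter, mem_union, mem_inter]
      constructor
      · rintro ⟨h1 | h1, -, h3⟩
        · exact absurd h3 (hJn x h1).2
        · exact h1
      · intro hx
        exact ⟨Or.inr hx, (hI1 x hx).1⟩
    · intro W hW
      simp only [mem_filter, mem_indepSets] at hW
      obtain ⟨⟨⟨hWV, hW⟩, rfl⟩, hvW⟩ := hW
      congr 1
      ext x
      simp only [mem_insert, mem_sdiff, mem_filter, mem_union, mem_inter, not_or, not_and]
      constructor
      · intro hx
        by_cases hr : r v x
        · exact Or.inr ⟨hx, hWV hx, hr⟩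
        · exact Or.inl ⟨hx, fun h => hvW (h ▸ hx), fun _ => hr⟩
      · rintro (h | h)
        · exact h.1
        · exact h.1

/-- The numerical trade-off: either the partition function of the available neighbourhood is
small, and `v` itself is likely to be chosen, or it is large, and many neighbours are. -/
lemma mul_add_hardCoreSum_le {Δ E B T : ℝ} (ht : 0 ≤ t) (ht' : t ≤ 1 / 2)
    (hsymm : ∀ a b, r a b → r b a) (hirr : ∀ a, ¬ r a a)
    (hE : t ^ 2 * E ≤ 1) (hB : 0 < B) (hT : 0 ≤ T) (hΔ : 0 ≤ Δ)
    (hTB : 2 * T ≤ Real.log B / 2 - 1) (hTΔ : T * (t + B) ≤ Δ * t) {X : Finset α}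
    (hX : ∑ a ∈ X, (#(X.filter (r a)) : ℝ) ≤ E) :
    T * (t + hardCoreSum r t X) ≤ Δ * t + ∑ I ∈ indepSets r X, (#I : ℝ) * t ^ #I := by
  have hZ := one_le_hardCoreSum (r := r) ht X
  have hS : 0 ≤ ∑ I ∈ indepSets r X, (#I : ℝ) * t ^ #I :=
    sum_nonneg fun _ _ => by positivity
  rcases le_total (hardCoreSum r t X) B with h | h
  · have : T * (t + hardCoreSum r t X) ≤ T * (t + B) := by gcongr
    linarith
  · have h1 : Real.log B ≤ t * #X := by
      calc Real.log B ≤ Real.log ((1 + t) ^ #X) :=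
            Real.log_le_log hB (h.trans (hardCoreSum_le_pow ht X))
        _ = #X * Real.log (1 + t) := Real.log_pow _ _
        _ ≤ #X * t := by
            gcongr
            have := Real.log_le_sub_one_of_pos (x := 1 + t) (by linarith)
            linarith
        _ = t * #X := mul_comm _ _
    have h2 := le_sum_card_mul_pow ht hsymm hirr X
    have h3 : 2 * T ≤ t * #X * (1 - t) - t ^ 2 * ∑ a ∈ X, (#(X.filter (r a)) : ℝ) := by
      have h4 : t ^ 2 * ∑ a ∈ X, (#(X.filter (r a)) : ℝ) ≤ 1 :=
        (mul_le_mul_of_nonneg_left hX (sq_nonneg t)).trans hE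
      have h5 : 0 ≤ t * (#X : ℝ) := by positivity
      nlinarith
    have h6 : hardCoreSum r t X * (2 * T) ≤ ∑ I ∈ indepSets r X, (#I : ℝ) * t ^ #I :=
      (mul_le_mul_of_nonneg_left h3 (by linarith)).trans h2
    have h7 : 0 ≤ Δ * t := by positivity
    nlinarith

/-- For every vertex `v`, the hard-core average of `Δ * 1[v ∈ W] + |N(v) ∩ W|` is at least `T`. -/
lemma vertex_average_le {Δ E B T : ℝ} (ht : 0 ≤ t) (ht' : t ≤ 1 / 2)
    (hsymm : ∀ a b, r a b → r b a) (hirr : ∀ a, ¬ r a a)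
    (hE : t ^ 2 * E ≤ 1) (hB : 0 < B) (hT : 0 ≤ T) (hΔ : 0 ≤ Δ)
    (hTB : 2 * T ≤ Real.log B / 2 - 1) (hTΔ : T * (t + B) ≤ Δ * t) {V : Finset α} {v : α}
    (hv : v ∈ V)
    (hloc : ∑ a ∈ V.filter (r v), (#((V.filter (r v)).filter (r a)) : ℝ) ≤ E) :
    T * hardCoreSum r t V ≤
      ∑ W ∈ indepSets r V, t ^ #W * (Δ * (if v ∈ W then 1 else 0) + #(W ∩ V.filter (r v))) := by
  set N := V.filter (r v) with hN
  have hvN : v ∉ N := by simp [hN, hirr]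
  have hmaps : ∀ W ∈ indepSets r V,
      W \ insert v N ∈ (indepSets r V).filter (Disjoint · (insert v N)) := by
    intro W hW
    rw [mem_indepSets] at hW
    simp only [mem_filter, mem_indepSets]
    exact ⟨⟨sdiff_subset.trans hW.1, fun x hx y hy =>
      hW.2 x (mem_sdiff.1 hx).1 y (mem_sdiff.1 hy).1⟩, sdiff_disjoint⟩
  rw [hardCoreSum, ← sum_fiberwise_of_maps_to hmaps, ← sum_fiberwise_of_maps_to hmaps, mul_sum]
  refine sum_le_sum fun J hJ => ?_
  obtain ⟨hJV, hJd⟩ := mem_filter.1 hJ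
  rw [sum_indepSets_fiber hsymm hirr hv hJV hJd, sum_indepSets_fiber hsymm hirr hv hJV hJd]
  set X := N.filter fun u => ∀ b ∈ J, ¬ r u b with hX
  have hXN : X ⊆ N := filter_subset _ _
  have hvJ : v ∉ J := fun h => disjoint_left.1 hJd h (mem_insert_self _ _)
  have hJN : Disjoint J N := hJd.mono_right (subset_insert _ _)
  have hIJ : ∀ I ∈ indepSets r X, #(J ∪ I) = #J + #I := fun I hI =>
    card_union_of_disjoint (hJN.mono_right ((mem_indepSets.1 hI).1.trans hXN))
  have hloc' : ∑ a ∈ X, (#(X.filter (r a)) : ℝ) ≤ E := by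
    refine le_trans ?_ hloc
    calc ∑ a ∈ X, (#(X.filter (r a)) : ℝ) ≤ ∑ a ∈ X, (#(N.filter (r a)) : ℝ) :=
          sum_le_sum fun a _ => by
            exact_mod_cast card_le_card (filter_subset_filter _ hXN)
      _ ≤ _ := sum_le_sum_of_subset_of_nonneg hXN fun _ _ _ => by positivity
  have key := mul_add_hardCoreSum_le ht ht' hsymm hirr hE hB hT hΔ hTB hTΔ hloc'
  have e1 : insert v J ∩ N = ∅ := by
    rw [insert_inter_of_notMem hvN, disjoint_iff_inter_eq_empty.1 hJN]
  have e2 : ∑ I ∈ indepSets r X, t ^ #(J ∪ I) = t ^ #J * hardCoreSum r t X := by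
    rw [hardCoreSum, mul_sum]
    exact sum_congr rfl fun I hI => by rw [hIJ I hI, pow_add]
  have e3 : ∑ I ∈ indepSets r X,
      t ^ #(J ∪ I) * (Δ * (if v ∈ J ∪ I then 1 else 0) + (#((J ∪ I) ∩ N) : ℝ)) =
      t ^ #J * ∑ I ∈ indepSets r X, (#I : ℝ) * t ^ #I := by
    rw [mul_sum]
    refine sum_congr rfl fun I hI => ?_
    have hIN : I ⊆ N := (mem_indepSets.1 hI).1.trans hXN
    have h1 : v ∉ J ∪ I := by
      rw [mem_union, not_or]; exact ⟨hvJ, fun h => hvN (hIN h)⟩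
    have h2 : (J ∪ I) ∩ N = I := by
      rw [union_inter_distrib_right, disjoint_iff_inter_eq_empty.1 hJN, empty_union,
        inter_eq_left.2 hIN]
    rw [hIJ I hI, pow_add, if_neg h1, h2]
    ring
  rw [e2, e3, e1, card_insert_of_notMem hvJ, if_pos (mem_insert_self _ _), card_empty, pow_succ]
  have := mul_le_mul_of_nonneg_left key (pow_nonneg ht #J)
  push_cast
  linarith

/-- A locally sparse relation of bounded degree has a large independent set. -/
theorem exists_indepSet_of_locally_sparse {Δ E B T : ℝ} (ht : 0 ≤ t) (ht' : t ≤ 1 / 2)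
    (hsymm : ∀ a b, r a b → r b a) (hirr : ∀ a, ¬ r a a)
    (hE : t ^ 2 * E ≤ 1) (hB : 0 < B) (hT : 0 ≤ T) (hΔ : 0 ≤ Δ)
    (hTB : 2 * T ≤ Real.log B / 2 - 1) (hTΔ : T * (t + B) ≤ Δ * t) {V : Finset α}
    (hdeg : ∀ v ∈ V, (#(V.filter (r v)) : ℝ) ≤ Δ)
    (hloc : ∀ v ∈ V, ∑ a ∈ V.filter (r v), (#((V.filter (r v)).filter (r a)) : ℝ) ≤ E) :
    ∃ W ⊆ V, (∀ a ∈ W, ∀ b ∈ W, ¬ r a b) ∧ T * #V ≤ 2 * Δ * #W := by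
  by_contra! hcon
  have h1 : ∑ v ∈ V, T * hardCoreSum r t V ≤ _ := sum_le_sum fun v hv =>
    vertex_average_le ht ht' hsymm hirr hE hB hT hΔ hTB hTΔ hv (hloc v hv)
  rw [sum_comm, sum_const, nsmul_eq_mul] at h1
  have h2 : ∀ W ∈ indepSets r V, ∑ v ∈ V,
      t ^ #W * (Δ * (if v ∈ W then 1 else 0) + (#(W ∩ V.filter (r v)) : ℝ)) ≤
      t ^ #W * (2 * Δ * #W) := by
    intro W hW
    have hWV := (mem_indepSets.1 hW).1
    rw [← mul_sum]
    refine mul_le_mul_of_nonneg_left ?_ (pow_nonneg ht _)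
    rw [sum_add_distrib, ← mul_sum]
    have e1 : ∑ v ∈ V, (if v ∈ W then (1 : ℝ) else 0) = #W := by
      rw [← sum_filter, sum_const, nsmul_eq_mul, mul_one, filter_mem_eq_inter,
        inter_eq_right.2 hWV]
    have e2 : ∑ v ∈ V, (#(W ∩ V.filter (r v)) : ℝ) = ∑ u ∈ W, (#(V.filter (r u)) : ℝ) := by
      have h3 : ∀ v ∈ V, (#(W ∩ V.filter (r v)) : ℝ) = ∑ u ∈ W, if r v u then 1 else 0 := by
        intro v _
        rw [← sum_filter, sum_const, nsmul_eq_mul, mul_one]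
        congr 2
        ext x
        simp only [mem_inter, mem_filter]
        exact ⟨fun h => ⟨h.1, h.2.2⟩, fun h => ⟨h.1, hWV h.1, h.2⟩⟩
      rw [sum_congr rfl h3, sum_comm]
      refine sum_congr rfl fun u _ => ?_
      rw [← sum_filter, sum_const, nsmul_eq_mul, mul_one]
      congr 2
      ext x
      simp only [mem_filter]
      exact ⟨fun h => ⟨h.1, hsymm _ _ h.2⟩, fun h => ⟨h.1, hsymm _ _ h.2⟩⟩
    have e3 : ∑ u ∈ W, (#(V.filter (r u)) : ℝ) ≤ #W * Δ := by
      rw [← nsmul_eq_mul]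
      exact sum_le_card_nsmul _ _ _ fun u hu => hdeg u (hWV hu)
    rw [e1, e2]
    linarith
  have hV : (∅ : Finset α) ∈ indepSets r V := by simp [mem_indepSets]
  have h3 : ∑ W ∈ indepSets r V, t ^ #W * (2 * Δ * #W) < ∑ W ∈ indepSets r V, t ^ #W * (T * #V) := by
    refine sum_lt_sum (fun W hW => ?_) ⟨∅, hV, ?_⟩
    · have h := mem_indepSets.1 hW
      exact mul_le_mul_of_nonneg_left (hcon W h.1 h.2).le (pow_nonneg ht _)
    · have := hcon ∅ (empty_subset _) (by simp)
      simpa using this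
  rw [← sum_mul, ← hardCoreSum] at h3
  have h4 := h1.trans (sum_le_sum h2)
  linarith

end HardCore

section EditBall

open Finset

/-- The words `u` and `v` have a common subsequence missing at most `k` letters of each. -/
def EditClose (k : ℕ) (u v : List Bool) : Prop :=
  ∃ z : List Bool, z.Sublist u ∧ z.Sublist v ∧ u.length ≤ z.length + k ∧ v.length ≤ z.length + k

lemma EditClose.symm {k : ℕ} {u v : List Bool} (h : EditClose k u v) : EditClose k v u := by
  obtain ⟨z, h1, h2, h3, h4⟩ := h
  exact ⟨z, h2, h1, h4, h3⟩

lemma exists_sublist_eraseIdx {α : Type*} {z v : List α} (h : z.Sublist v)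
    (hlt : z.length < v.length) : ∃ i < v.length, z.Sublist (v.eraseIdx i) := by
  induction h with
  | slnil => simp at hlt
  | cons a h _ => exact ⟨0, by simp, by simpa using h⟩
  | cons_cons a h ih =>
    obtain ⟨i, hi, hs⟩ := ih (by simpa using hlt)
    exact ⟨i + 1, by simpa using hi, by simpa using hs⟩

/-- Words obtained from `v` by deleting at most one letter. -/
def deleteStep (v : List Bool) : Finset (List Bool) :=
  insert v ((range v.length).image v.eraseIdx)

/-- Words obtained from `v` by inserting at most one letter. -/
def insertStep (v : List Bool) : Finset (List Bool) :=
  insert v ((range (v.length + 1) ×ˢ univ).image fun p => v.insertIdx p.1 p.2)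

/-- Words obtained from `v` by deleting at most `k` letters. -/
def deletions : ℕ → List Bool → Finset (List Bool)
  | 0, v => {v}
  | k + 1, v => (deleteStep v).biUnion (deletions k)

/-- Words obtained from `v` by inserting at most `k` letters. -/
def insertions : ℕ → List Bool → Finset (List Bool)
  | 0, v => {v}
  | k + 1, v => (insertions k v).biUnion insertStep

/-- Words obtained from `v` by deleting at most `k` letters and then inserting at most `k`. -/
def editBall (k : ℕ) (v : List Bool) : Finset (List Bool) :=
  (deletions k v).biUnion (insertions k)

lemma card_deleteStep_le (v : List Bool) : #(deleteStep v) ≤ v.length + 1 := by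
  refine (card_insert_le _ _).trans ?_
  gcongr
  exact card_image_le.trans (by simp)

lemma card_insertStep_le (v : List Bool) : #(insertStep v) ≤ 2 * v.length + 3 := by
  refine (card_insert_le _ _).trans ?_
  have : #((range (v.length + 1) ×ˢ (univ : Finset Bool)).image
      fun p => v.insertIdx p.1 p.2) ≤ 2 * v.length + 2 :=
    card_image_le.trans (by simp [card_product]; omega)
  omega

lemma length_le_of_mem_deleteStep {u v : List Bool} (h : u ∈ deleteStep v) :
    u.length ≤ v.length := by
  simp only [deleteStep, mem_insert, mem_image, mem_range] at h
  rcases h with rfl | ⟨i, -, rfl⟩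
  · exact le_rfl
  · exact (List.eraseIdx_sublist v i).length_le

lemma length_le_of_mem_insertStep {u v : List Bool} (h : u ∈ insertStep v) :
    u.length ≤ v.length + 1 := by
  simp only [insertStep, mem_insert, mem_image] at h
  rcases h with rfl | ⟨p, -, rfl⟩
  · omega
  · rw [List.length_insertIdx]; split <;> omega

lemma card_deletions_le (k : ℕ) (v : List Bool) : #(deletions k v) ≤ (v.length + 1) ^ k := by
  induction k generalizing v with
  | zero => simp [deletions]
  | succ k ih =>
    rw [deletions, pow_succ']
    refine (card_biUnion_le_card_mul _ _ ((v.length + 1) ^ k) fun u hu => ?_).trans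
      (Nat.mul_le_mul_right _ (card_deleteStep_le v))
    refine (ih u).trans ?_
    gcongr
    exact length_le_of_mem_deleteStep hu

lemma length_le_of_mem_deletions {k : ℕ} {u v : List Bool} (h : u ∈ deletions k v) :
    u.length ≤ v.length := by
  induction k generalizing v with
  | zero => simp only [deletions, mem_singleton] at h; rw [h]
  | succ k ih =>
    obtain ⟨y, hy, hu⟩ := mem_biUnion.1 h
    exact (ih hu).trans (length_le_of_mem_deleteStep hy)

lemma length_le_of_mem_insertions {k : ℕ} {u v : List Bool} (h : u ∈ insertions k v) :
    u.length ≤ v.length + k := by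
  induction k generalizing u with
  | zero => simp only [insertions, mem_singleton] at h; simp [h]
  | succ k ih =>
    obtain ⟨y, hy, hu⟩ := mem_biUnion.1 h
    have := ih hy
    have := length_le_of_mem_insertStep hu
    omega

lemma card_insertions_le (k : ℕ) (v : List Bool) :
    #(insertions k v) ≤ (2 * (v.length + k) + 3) ^ k := by
  induction k with
  | zero => simp [insertions]
  | succ k ih =>
    rw [insertions, pow_succ]
    refine (card_biUnion_le_card_mul _ _ (2 * (v.length + (k + 1)) + 3) fun u hu => ?_).trans
      (Nat.mul_le_mul_right _ (ih.trans ?_))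
    · refine (card_insertStep_le u).trans ?_
      have := length_le_of_mem_insertions hu
      omega
    · gcongr
      omega

lemma card_editBall_le (k : ℕ) (v : List Bool) :
    #(editBall k v) ≤ (2 * (v.length + k) + 3) ^ (2 * k) := by
  rw [two_mul k, pow_add]
  refine (card_biUnion_le_card_mul _ _ ((2 * (v.length + k) + 3) ^ k) fun u hu => ?_).trans
    (Nat.mul_le_mul_right _ ((card_deletions_le k v).trans ?_))
  · refine (card_insertions_le k u).trans ?_
    gcongr
    exact length_le_of_mem_deletions hu
  · exact Nat.pow_le_pow_left (by omega) k

lemma mem_deletions {k : ℕ} {z v : List Bool} (h : z.Sublist v)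
    (hl : v.length ≤ z.length + k) : z ∈ deletions k v := by
  induction k generalizing v with
  | zero => simp [deletions, h.eq_of_length_le (by simpa using hl)]
  | succ k ih =>
    rw [deletions, mem_biUnion]
    rcases h.length_le.lt_or_eq with hlt | heq
    · obtain ⟨i, hi, hs⟩ := exists_sublist_eraseIdx h hlt
      refine ⟨v.eraseIdx i, ?_, ih hs ?_⟩
      · exact mem_insert_of_mem (mem_image.2 ⟨i, mem_range.2 hi, rfl⟩)
      · rw [List.length_eraseIdx_of_lt hi]; omega
    · exact ⟨v, mem_insert_self _ _, ih h (by omega)⟩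

lemma mem_insertions {k : ℕ} {z u : List Bool} (h : z.Sublist u)
    (hl : u.length ≤ z.length + k) : u ∈ insertions k z := by
  induction k generalizing u with
  | zero => simp [insertions, h.eq_of_length_le (by simpa using hl)]
  | succ k ih =>
    rw [insertions, mem_biUnion]
    rcases h.length_le.lt_or_eq with hlt | heq
    · obtain ⟨i, hi, hs⟩ := exists_sublist_eraseIdx h hlt
      refine ⟨u.eraseIdx i, ih hs ?_, ?_⟩
      · rw [List.length_eraseIdx_of_lt hi]; omega
      · refine mem_insert_of_mem (mem_image.2 ⟨(i, u[i]), ?_, ?_⟩)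
        · simp only [mem_product, mem_range, mem_univ, and_true]
          rw [List.length_eraseIdx_of_lt hi]; omega
        · exact List.insertIdx_eraseIdx_getElem hi
    · exact ⟨u, ih h (by omega), mem_insert_self _ _⟩

lemma EditClose.mem_editBall {k : ℕ} {u v : List Bool} (h : EditClose k v u) :
    u ∈ editBall k v := by
  obtain ⟨z, h1, h2, h3, h4⟩ := h
  exact mem_biUnion.2 ⟨z, mem_deletions h1 h3, mem_insertions h2 h4⟩

end EditBall

section Blocks

open Finset

/-- The concatenation `f 0 ++ f 1 ++ ⋯ ++ f (m - 1)`. -/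
def blockConcat (f : ℕ → List Bool) : ℕ → List Bool
  | 0 => []
  | m + 1 => blockConcat f m ++ f m

lemma length_blockConcat (f : ℕ → List Bool) (m : ℕ) :
    (blockConcat f m).length = ∑ i ∈ range m, (f i).length := by
  induction m with
  | zero => rfl
  | succ m ih => rw [blockConcat, List.length_append, ih, sum_range_succ]

lemma blockConcat_congr {f g : ℕ → List Bool} {m : ℕ} (h : ∀ i < m, f i = g i) :
    blockConcat f m = blockConcat g m := by
  induction m with
  | zero => rfl
  | succ m ih =>
    rw [blockConcat, blockConcat, ih fun i hi => h i (by omega), h m (by omega)]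

lemma exists_blockConcat_of_sublist {f : ℕ → List Bool} {m : ℕ} {z : List Bool}
    (h : z.Sublist (blockConcat f m)) :
    ∃ g : ℕ → List Bool, z = blockConcat g m ∧ ∀ i < m, (g i).Sublist (f i) := by
  induction m generalizing z with
  | zero => exact ⟨fun _ => [], by simpa [blockConcat] using h, by simp⟩
  | succ m ih =>
    obtain ⟨z₁, z₂, rfl, h₁, h₂⟩ := List.sublist_append_iff.1 h
    obtain ⟨g, rfl, hg⟩ := ih h₁
    refine ⟨Function.update g m z₂, ?_, fun i hi => ?_⟩
    · rw [blockConcat, Function.update_self]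
      congr 1
      exact blockConcat_congr fun i hi => by rw [Function.update_of_ne (by omega)]
    · by_cases him : i = m
      · subst him; simpa using h₂
      · rw [Function.update_of_ne him]; exact hg i (by omega)

lemma exists_blockConcat_of_sublist' {g : ℕ → List Bool} {m : ℕ} {u : List Bool} (hm : 0 < m)
    (h : (blockConcat g m).Sublist u) :
    ∃ f : ℕ → List Bool, u = blockConcat f m ∧ ∀ i < m, (g i).Sublist (f i) := by
  induction m generalizing u with
  | zero => omega
  | succ m ih =>
    rcases Nat.eq_zero_or_pos m with rfl | hm'
    · refine ⟨fun _ => u, by simp [blockConcat], fun i hi => ?_⟩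
      obtain rfl : i = 0 := by omega
      simpa [blockConcat] using h
    obtain ⟨u₁, u₂, rfl, h₁, h₂⟩ := List.append_sublist_iff.1 h
    obtain ⟨f, rfl, hf⟩ := ih hm' h₁
    refine ⟨Function.update f m u₂, ?_, fun i hi => ?_⟩
    · rw [blockConcat, Function.update_self]
      congr 1
      exact blockConcat_congr fun i hi => by rw [Function.update_of_ne (by omega)]
    · by_cases him : i = m
      · subst him; simpa using h₂
      · rw [Function.update_of_ne him]; exact hf i (by omega)

/-- A word close to a concatenation of blocks is a concatenation of modified blocks, where
`c i` counts the edits inside block `i`. -/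
lemma EditClose.exists_blocks {k m : ℕ} (hm : 0 < m) {f : ℕ → List Bool} {u : List Bool}
    (h : EditClose k (blockConcat f m) u) :
    ∃ (g : ℕ → List Bool) (c : ℕ → ℕ), u = blockConcat g m ∧ ∑ i ∈ range m, c i ≤ 2 * k ∧
      ∀ i < m, g i ∈ editBall k (f i) ∧ (c i = 0 → g i = f i) ∧
        (c i = 1 → (g i).length ≠ (f i).length) ∧
        (g i).length ≤ (f i).length + c i ∧ (f i).length ≤ (g i).length + c i := by
  obtain ⟨z, h1, h2, h3, h4⟩ := h
  obtain ⟨e, rfl, he⟩ := exists_blockConcat_of_sublist h1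
  obtain ⟨g, rfl, hg⟩ := exists_blockConcat_of_sublist' hm h2
  rw [length_blockConcat, length_blockConcat] at h3 h4
  have hf : ∑ i ∈ range m, ((f i).length - (e i).length) ≤ k := by
    have : ∑ i ∈ range m, ((f i).length - (e i).length) + ∑ i ∈ range m, (e i).length =
        ∑ i ∈ range m, (f i).length := by
      rw [← sum_add_distrib]
      exact sum_congr rfl fun i hi => Nat.sub_add_cancel (he i (mem_range.1 hi)).length_le
    omega
  have hgk : ∑ i ∈ range m, ((g i).length - (e i).length) ≤ k := by
    have : ∑ i ∈ range m, ((g i).length - (e i).length) + ∑ i ∈ range m, (e i).length =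
        ∑ i ∈ range m, (g i).length := by
      rw [← sum_add_distrib]
      exact sum_congr rfl fun i hi => Nat.sub_add_cancel (hg i (mem_range.1 hi)).length_le
    omega
  refine ⟨g, fun i => ((f i).length - (e i).length) + ((g i).length - (e i).length), rfl, ?_,
    fun i hi => ?_⟩
  · rw [sum_add_distrib]; omega
  · have a1 := (he i hi).length_le
    have a2 := (hg i hi).length_le
    have b1 := (single_le_sum (f := fun i => (f i).length - (e i).length)
      (fun _ _ => Nat.zero_le _) (mem_range.2 hi)).trans hf
    have b2 := (single_le_sum (f := fun i => (g i).length - (e i).length)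
      (fun _ _ => Nat.zero_le _) (mem_range.2 hi)).trans hgk
    dsimp only
    refine ⟨EditClose.mem_editBall ⟨e i, he i hi, hg i hi, by omega, by omega⟩, fun h0 => ?_,
      fun h0 => by omega, by omega, by omega⟩
    rw [← (he i hi).eq_of_length_le (by omega), (hg i hi).eq_of_length_le (by omega)]

lemma length_blockConcat_le {f g : ℕ → List Bool} {c : ℕ → ℕ} {m j K : ℕ} (hj : j ≤ m)
    (hc : ∑ i ∈ range m, c i ≤ K) (h : ∀ i < m, (f i).length ≤ (g i).length + c i) :
    (blockConcat f j).length ≤ (blockConcat g j).length + K := by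
  rw [length_blockConcat, length_blockConcat]
  have h1 : ∑ i ∈ range j, c i ≤ ∑ i ∈ range m, c i :=
    sum_le_sum_of_subset (range_subset_range.2 hj)
  have h2 : ∑ i ∈ range j, (f i).length ≤ ∑ i ∈ range j, ((g i).length + c i) :=
    sum_le_sum fun i hi => h i (by have := mem_range.1 hi; omega)
  rw [sum_add_distrib] at h2
  omega

lemma exists_blockConcat_eq_append (f : ℕ → List Bool) {j m : ℕ} (h : j ≤ m) :
    ∃ t, blockConcat f m = blockConcat f j ++ t := by
  induction m, h using Nat.le_induction with
  | base => exact ⟨[], by simp⟩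
  | succ m _ ih =>
    obtain ⟨t, ht⟩ := ih
    exact ⟨t ++ f m, by rw [blockConcat, ht, List.append_assoc]⟩

/-- The word `b` has no period `s` with `1 ≤ s ≤ K`. -/
def NoShortPeriod (K : ℕ) (b : List Bool) : Prop :=
  ∀ s, 1 ≤ s → s ≤ K → ∃ j, j + s < b.length ∧ b[j]? ≠ b[j + s]?

lemma NoShortPeriod.length_le {K : ℕ} {b P R P' R' : List Bool} (hb : NoShortPeriod K b)
    (h : P ++ (b ++ R) = P' ++ (b ++ R')) (hP : P'.length ≤ P.length + K) :
    P'.length ≤ P.length := by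
  by_contra! hlt
  obtain ⟨j, hj, hne⟩ := hb (P'.length - P.length) (by omega) (by omega)
  apply hne
  have h1 : (P' ++ (b ++ R'))[P'.length + j]? = b[j]? := by
    rw [List.getElem?_append_right (by omega), Nat.add_sub_cancel_left,
      List.getElem?_append_left (by omega)]
  have h2 : (P ++ (b ++ R))[P'.length + j]? = b[j + (P'.length - P.length)]? := by
    rw [List.getElem?_append_right (by omega), List.getElem?_append_left (by omega)]
    congr 1
    omega
  rw [← h1, ← h2, h]

lemma NoShortPeriod.length_eq {K : ℕ} {b P R P' R' : List Bool} (hb : NoShortPeriod K b)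
    (h : P ++ (b ++ R) = P' ++ (b ++ R')) (hP : P'.length ≤ P.length + K)
    (hP' : P.length ≤ P'.length + K) : P.length = P'.length :=
  le_antisymm (hb.length_le h.symm hP') (hb.length_le h hP)

/-- If the block `i` sits between two common aperiodic blocks, then the two parsings of the same
word give it the same length. -/
lemma length_eq_of_blockConcat_eq {a b : ℕ → List Bool} {m i K : ℕ} (hi : i + 2 < m)
    (h : blockConcat a m = blockConcat b m) (h0 : a i = b i) (h2 : a (i + 2) = b (i + 2))
    (hp0 : NoShortPeriod K (a i)) (hp2 : NoShortPeriod K (a (i + 2)))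
    (hl : (blockConcat a i).length ≤ (blockConcat b i).length + K)
    (hl' : (blockConcat b i).length ≤ (blockConcat a i).length + K)
    (hm : (a (i + 1)).length ≤ (b (i + 1)).length + K)
    (hm' : (b (i + 1)).length ≤ (a (i + 1)).length + K) :
    (a (i + 1)).length = (b (i + 1)).length := by
  obtain ⟨s, hs⟩ := exists_blockConcat_eq_append a (show i + 3 ≤ m by omega)
  obtain ⟨t, ht⟩ := exists_blockConcat_eq_append b (show i + 3 ≤ m by omega)
  rw [hs, ht] at h
  simp only [blockConcat] at h
  rw [← h0, ← h2] at h
  have e1 : (blockConcat a i).length = (blockConcat b i).length := by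
    refine hp0.length_eq (R := a (i + 1) ++ (a (i + 2) ++ s))
      (R' := b (i + 1) ++ (a (i + 2) ++ t)) (by simpa [List.append_assoc] using h) hl' hl
  have e2 : (blockConcat a i ++ (a i ++ a (i + 1))).length =
      (blockConcat b i ++ (a i ++ b (i + 1))).length := by
    refine hp2.length_eq (R := s) (R' := t) (by simpa [List.append_assoc] using h) ?_ ?_ <;>
    · simp only [List.length_append]; omega
  simp only [List.length_append] at e2
  omega

end Blocks

section LocalSparsity

open Finset Classical

/-- If all edits from `f` to `a` and from `f` to `b` are isolated and the blocks of `f` are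
aperiodic, then the concatenations of `a` and `b` are not close to one another. -/
lemma not_editClose_of_isolated {k m : ℕ} (hk : 1 ≤ k) {f a b : ℕ → List Bool} {c d : ℕ → ℕ}
    (hc : ∑ i ∈ range m, c i ≤ 2 * k) (hd : ∑ i ∈ range m, d i ≤ 2 * k)
    (ha : ∀ i < m, (c i = 0 → a i = f i) ∧ (c i = 1 → (a i).length ≠ (f i).length) ∧
        (a i).length ≤ (f i).length + c i ∧ (f i).length ≤ (a i).length + c i)
    (hb : ∀ i < m, (d i = 0 → b i = f i) ∧ (d i = 1 → (b i).length ≠ (f i).length) ∧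
        (b i).length ≤ (f i).length + d i ∧ (f i).length ≤ (b i).length + d i)
    {T : Finset ℕ} (hT : T = (range m).filter fun i => c i + d i ≠ 0) (hTc : #T = 4 * k)
    (hTi : ∀ i ∈ T, 1 ≤ i ∧ i + 3 ≤ m) (hTs : ∀ i ∈ T, ∀ j ∈ T, i < j → i + 3 ≤ j)
    (hf : ∀ i, i + 2 ≤ m → NoShortPeriod (6 * k) (f i)) :
    ¬ EditClose k (blockConcat a m) (blockConcat b m) := by
  intro hclose
  have hm : 0 < m := by
    have : T.Nonempty := by rw [← card_pos]; omega
    obtain ⟨i, hi⟩ := this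
    have := hTi i hi
    omega
  obtain ⟨b', e, hbb, he, hb'⟩ := hclose.exists_blocks hm
  -- every touched block carries exactly one edit
  have hone : ∀ i ∈ T, c i + d i = 1 := by
    have hge : ∀ i ∈ T, 1 ≤ c i + d i := fun i hi => by
      rw [hT, mem_filter] at hi; omega
    have hsum : ∑ i ∈ T, (c i + d i) ≤ ∑ i ∈ T, 1 := by
      have h1 : ∑ i ∈ T, (c i + d i) ≤ ∑ i ∈ range m, (c i + d i) :=
        sum_le_sum_of_subset (by rw [hT]; exact filter_subset _ _)
      rw [sum_add_distrib] at h1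
      rw [sum_const, smul_eq_mul, mul_one, hTc, sum_add_distrib]
      rw [sum_add_distrib] at h1
      omega
    have heq := (sum_eq_sum_iff_of_le hge).1 (le_antisymm (sum_le_sum hge) hsum)
    exact fun i hi => (heq i hi).symm
  have hzero : ∀ i < m, i ∉ T → c i = 0 ∧ d i = 0 := fun i hi hiT => by
    rw [hT, mem_filter, not_and, not_not] at hiT
    have := hiT (mem_range.2 hi)
    omega
  -- some touched block and both its neighbours are aligned without edits
  obtain ⟨i, hiT, hi0, hi1, hi2⟩ : ∃ i ∈ T, e (i - 1) = 0 ∧ e i = 0 ∧ e (i + 1) = 0 := by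
    by_contra! hno
    set O := (range m).filter fun i => e i ≠ 0 with hO
    have hOc : #O ≤ 2 * k := by
      refine le_trans ?_ he
      rw [card_eq_sum_ones]
      refine (sum_le_sum fun i hi => ?_).trans (sum_le_sum_of_subset (filter_subset _ _))
      rw [mem_filter] at hi; omega
    have hex : ∀ i ∈ T, ∃ j ∈ O, i ≤ j + 1 ∧ j ≤ i + 1 := by
      intro i hi
      have := hTi i hi
      by_cases h0 : e (i - 1) = 0
      · by_cases h1 : e i = 0
        · exact ⟨i + 1, by rw [hO, mem_filter, mem_range]; exact ⟨by omega, hno i hi h0 h1⟩,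
            by omega, by omega⟩
        · exact ⟨i, by rw [hO, mem_filter, mem_range]; exact ⟨by omega, h1⟩, by omega, by omega⟩
      · exact ⟨i - 1, by rw [hO, mem_filter, mem_range]; exact ⟨by omega, h0⟩,
          by omega, by omega⟩
    choose! φ hφO hφ1 hφ2 using hex
    have hcard : #T ≤ #O := by
      refine card_le_card_of_injOn φ hφO fun i hi j hj hij => ?_
      have h1 := hφ1 i hi
      have h2 := hφ2 i hi
      have h3 := hφ1 j hj
      have h4 := hφ2 j hj
      by_contra hne
      rcases Nat.lt_or_gt_of_ne hne with h | h
      · have := hTs i hi j hj h; omega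
      · have := hTs j hj i hi h; omega
    omega
  obtain ⟨h1i, hi3⟩ := hTi i hiT
  obtain ⟨p, rfl⟩ : ∃ p, i = p + 1 := ⟨i - 1, by omega⟩
  rw [Nat.add_sub_cancel] at hi0
  have hpT : p ∉ T := fun h => by have := hTs p h (p + 1) hiT (by omega); omega
  have hqT : p + 1 + 1 ∉ T := fun h => by have := hTs (p + 1) hiT _ h (by omega); omega
  obtain ⟨cp, dp⟩ := hzero p (by omega) hpT
  obtain ⟨cq, dq⟩ := hzero (p + 1 + 1) (by omega) hqT
  have bp : b p = f p := (hb p (by omega)).1 dp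
  have bq : b (p + 2) = f (p + 2) := (hb (p + 2) (by omega)).1 dq
  have bp' : b' p = f p := ((hb' p (by omega)).2.1 hi0).trans ((ha p (by omega)).1 cp)
  have bq' : b' (p + 2) = f (p + 2) :=
    ((hb' (p + 2) (by omega)).2.1 hi2).trans ((ha (p + 2) (by omega)).1 cq)
  have br' : b' (p + 1) = a (p + 1) := (hb' (p + 1) (by omega)).2.1 hi1
  have l1 := length_blockConcat_le (j := p) (by omega) he fun i hi => (hb' i hi).2.2.2.1
  have l2 := length_blockConcat_le (j := p) (by omega) he fun i hi => (hb' i hi).2.2.2.2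
  have l3 := length_blockConcat_le (j := p) (by omega) hc fun i hi => (ha i hi).2.2.1
  have l4 := length_blockConcat_le (j := p) (by omega) hc fun i hi => (ha i hi).2.2.2
  have l5 := length_blockConcat_le (j := p) (by omega) hd fun i hi => (hb i hi).2.2.1
  have l6 := length_blockConcat_le (j := p) (by omega) hd fun i hi => (hb i hi).2.2.2
  have hr := hone _ hiT
  have har := ha (p + 1) (by omega)
  have hbr := hb (p + 1) (by omega)
  have hlen : (b (p + 1)).length = (b' (p + 1)).length := by
    refine length_eq_of_blockConcat_eq (K := 6 * k) (by omega) hbb (bp.trans bp'.symm)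
      (bq.trans bq'.symm) ?_ ?_ (by omega) (by omega) ?_ ?_
    · rw [bp]; exact hf p (by omega)
    · rw [bq]; exact hf (p + 2) (by omega)
    · rw [br']; omega
    · rw [br']; omega
  rw [br'] at hlen
  have hcd : (c (p + 1) = 0 ∧ d (p + 1) = 1) ∨ (c (p + 1) = 1 ∧ d (p + 1) = 0) := by omega
  rcases hcd with ⟨h0, h1⟩ | ⟨h1, h0⟩
  · exact hbr.2.1 h1 (hlen.trans (by rw [har.1 h0]))
  · exact har.2.1 h1 (hlen.symm.trans (by rw [hbr.1 h0]))

/-- The indices within distance two of `R`, together with the extreme indices. -/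
def indexClosure (m : ℕ) (R : Finset ℕ) : Finset ℕ :=
  (R.biUnion fun j => Icc (j - 2) (j + 2)) ∪ {0, m - 1, m - 2}

lemma card_indexClosure_le (m : ℕ) (R : Finset ℕ) : #(indexClosure m R) ≤ #R * 5 + 3 := by
  refine (card_union_le _ _).trans (add_le_add ?_ card_le_three)
  refine card_biUnion_le_card_mul _ _ _ fun j _ => ?_
  rw [Nat.card_Icc]
  omega

lemma subset_indexClosure (m : ℕ) (R : Finset ℕ) : R ⊆ indexClosure m R := fun j hj =>
  mem_union_left _ (mem_biUnion.2 ⟨j, hj, by simp⟩)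

/-- A set of at most `q` indices is either isolated or in the closure of `q - 1` indices. -/
lemma exists_subset_indexClosure_or {m q : ℕ} (hq : 1 ≤ q) (hqm : q ≤ m) {T : Finset ℕ}
    (hT : T ⊆ range m) (hTq : #T ≤ q) :
    (∃ R ∈ powersetCard (q - 1) (range m), T ⊆ indexClosure m R) ∨
    (#T = q ∧ (∀ i ∈ T, 1 ≤ i ∧ i + 3 ≤ m) ∧ ∀ i ∈ T, ∀ j ∈ T, i < j → i + 3 ≤ j) := by
  have hext : ∀ R ⊆ range m, #R ≤ q - 1 → T ⊆ indexClosure m R →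
      ∃ R ∈ powersetCard (q - 1) (range m), T ⊆ indexClosure m R := by
    intro R hR hRq hTR
    obtain ⟨R', h1, h2, h3⟩ := exists_subsuperset_card_eq hR hRq (by rw [card_range]; omega)
    refine ⟨R', mem_powersetCard.2 ⟨h2, h3⟩, hTR.trans ?_⟩
    exact union_subset_union (biUnion_subset_biUnion_of_subset_left _ h1) subset_rfl
  have herase : ∀ i ∈ T, i ∈ indexClosure m (T.erase i) →
      ∃ R ∈ powersetCard (q - 1) (range m), T ⊆ indexClosure m R := by
    intro i hi hiR
    refine hext (T.erase i) ((erase_subset _ _).trans hT)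
      (by rw [card_erase_of_mem hi]; omega) fun j hj => ?_
    by_cases hij : j = i
    · rwa [hij]
    · exact subset_indexClosure _ _ (mem_erase.2 ⟨hij, hj⟩)
  by_contra! hcon
  obtain ⟨hno, hbad⟩ := hcon
  have hno' : ¬ ∃ R ∈ powersetCard (q - 1) (range m), T ⊆ indexClosure m R := by
    rintro ⟨R, h1, h2⟩; exact hno R h1 h2
  have h1 : #T = q := by
    by_contra hne
    exact hno' (hext T hT (by omega) (subset_indexClosure _ _))
  have h2 : ∀ i ∈ T, 1 ≤ i ∧ i + 3 ≤ m := by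
    intro i hi
    by_contra hni
    refine hno' (herase i hi (mem_union_right _ ?_))
    have := mem_range.1 (hT hi)
    simp only [mem_insert, mem_singleton]
    omega
  obtain ⟨i, hi, j, hj, hij, hlt⟩ := hbad h1 h2
  refine hno' (herase i hi (mem_union_left _ (mem_biUnion.2
    ⟨j, mem_erase.2 ⟨by omega, hj⟩, ?_⟩)))
  rw [mem_Icc]
  omega

/-- All concatenations of blocks `g i ∈ A i`, for `i < m`. -/
noncomputable def blockProducts (A : ℕ → Finset (List Bool)) : ℕ → Finset (List Bool)
  | 0 => {[]}
  | m + 1 => image₂ (· ++ ·) (blockProducts A m) (A m)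

lemma card_blockProducts_le (A : ℕ → Finset (List Bool)) (m : ℕ) :
    #(blockProducts A m) ≤ ∏ i ∈ range m, #(A i) := by
  induction m with
  | zero => simp [blockProducts]
  | succ m ih =>
    rw [blockProducts, prod_range_succ]
    exact (card_image₂_le _ _ _).trans (Nat.mul_le_mul_right _ ih)

lemma blockConcat_mem_blockProducts {A : ℕ → Finset (List Bool)} {g : ℕ → List Bool} {m : ℕ}
    (h : ∀ i < m, g i ∈ A i) : blockConcat g m ∈ blockProducts A m := by
  induction m with
  | zero => simp [blockProducts, blockConcat]
  | succ m ih => exact mem_image₂_of_mem (ih fun i hi => h i (by omega)) (h m (by omega))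

/-- Words obtained from the blocks of `f` by editing only blocks with index in `S`. -/
noncomputable def modifiedWords (k : ℕ) (f : ℕ → List Bool) (m : ℕ) (S : Finset ℕ) :
    Finset (List Bool) :=
  blockProducts (fun i => if i ∈ S then editBall k (f i) else {f i}) m

lemma card_modifiedWords_le {k m X q : ℕ} {f : ℕ → List Bool} {S : Finset ℕ} (hX : 1 ≤ X)
    (hf : ∀ i, #(editBall k (f i)) ≤ X) (hS : #S ≤ q) : #(modifiedWords k f m S) ≤ X ^ q := by
  refine (card_blockProducts_le _ _).trans ?_
  calc ∏ i ∈ range m, #(if i ∈ S then editBall k (f i) else {f i})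
      ≤ ∏ i ∈ range m, (if i ∈ S then X else 1) := by
        refine prod_le_prod' fun i _ => ?_
        split_ifs
        · exact hf i
        · simp
    _ = X ^ #((range m).filter (· ∈ S)) := by rw [← prod_filter, prod_const]
    _ ≤ X ^ q := by
        refine Nat.pow_le_pow_right hX (le_trans (card_le_card fun i hi => ?_) hS)
        exact (mem_filter.1 hi).2

/-- The number of adjacent pairs in the neighbourhood of a concatenation of aperiodic blocks. -/
lemma sum_card_common_neighbours_le {k m X : ℕ} (hk : 1 ≤ k) (hm : 4 * k ≤ m) (hX : 1 ≤ X)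
    {f : ℕ → List Bool} (hf : ∀ i, i + 2 ≤ m → NoShortPeriod (6 * k) (f i))
    (hfX : ∀ i, #(editBall k (f i)) ≤ X) {N : Finset (List Bool)}
    (hN : ∀ u ∈ N, EditClose k (blockConcat f m) u) {r : List Bool → List Bool → Prop}
    (hr : ∀ u w, r u w → EditClose k u w) :
    ∑ u ∈ N, #(N.filter (r u)) ≤ m ^ (4 * k - 1) * (X ^ (20 * k) * X ^ (20 * k)) := by
  set P := (powersetCard (4 * k - 1) (range m)).biUnion fun R =>
    modifiedWords k f m (indexClosure m R) ×ˢ modifiedWords k f m (indexClosure m R) with hP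
  have hPc : #P ≤ m ^ (4 * k - 1) * (X ^ (20 * k) * X ^ (20 * k)) := by
    refine (card_biUnion_le_card_mul _ _ (X ^ (20 * k) * X ^ (20 * k)) fun R hR => ?_).trans
      (Nat.mul_le_mul_right _ ?_)
    · have h := card_indexClosure_le m R
      rw [(mem_powersetCard.1 hR).2] at h
      rw [card_product]
      have := card_modifiedWords_le (m := m) (S := indexClosure m R) (q := 20 * k) hX hfX (by omega)
      exact Nat.mul_le_mul this this
    · rw [card_powersetCard, card_range]
      exact Nat.choose_le_pow _ _
  rw [← card_sigma]
  refine le_trans (card_le_card_of_injOn (t := P) (fun x => (x.1, x.2)) ?_ ?_) hPc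
  · rintro ⟨u, w⟩ hx
    simp only [coe_sigma, Set.mem_sigma_iff, mem_coe, mem_filter] at hx
    obtain ⟨hu, hw, huw⟩ := hx
    obtain ⟨a, c, rfl, hc, ha⟩ := (hN u hu).exists_blocks (by omega)
    obtain ⟨b, d, rfl, hd, hb⟩ := (hN w hw).exists_blocks (by omega)
    set T := (range m).filter fun i => c i + d i ≠ 0 with hT
    have hTc : #T ≤ 4 * k := by
      have h1 : #T ≤ ∑ i ∈ range m, (c i + d i) := by
        rw [card_eq_sum_ones]
        refine (sum_le_sum fun i hi => ?_).trans (sum_le_sum_of_subset (filter_subset _ _))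
        rw [hT, mem_filter] at hi; omega
      rw [sum_add_distrib] at h1
      omega
    rcases exists_subset_indexClosure_or (by omega) hm (filter_subset _ _) hTc with
      ⟨R, hR, hTR⟩ | ⟨h1, h2, h3⟩
    · rw [hP]
      refine mem_coe.2 (mem_biUnion.2 ⟨R, hR, mem_product.2 ⟨?_, ?_⟩⟩)
      · refine blockConcat_mem_blockProducts fun i hi => ?_
        split_ifs with hiS
        · exact (ha i hi).1
        · have : i ∉ T := fun h => hiS (hTR h)
          rw [hT, mem_filter, not_and, not_not] at this
          have := this (mem_range.2 hi)
          rw [(ha i hi).2.1 (by omega), mem_singleton]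
      · refine blockConcat_mem_blockProducts fun i hi => ?_
        split_ifs with hiS
        · exact (hb i hi).1
        · have : i ∉ T := fun h => hiS (hTR h)
          rw [hT, mem_filter, not_and, not_not] at this
          have := this (mem_range.2 hi)
          rw [(hb i hi).2.1 (by omega), mem_singleton]
    · exact absurd (hr _ _ huw) (not_editClose_of_isolated hk hc hd (fun i hi => (ha i hi).2)
        (fun i hi => (hb i hi).2) hT h1 h2 h3 hf)
  · rintro ⟨u, w⟩ _ ⟨u', w'⟩ _ h
    simp only [Prod.mk.injEq] at h
    obtain ⟨rfl, rfl⟩ := h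
    rfl

end LocalSparsity

section Words

open Finset Classical

/-- The binary words of length `n`. -/
noncomputable def binaryWords (n : ℕ) : Finset (List Bool) :=
  (univ : Finset (Fin n → Bool)).image List.ofFn

lemma mem_binaryWords {n : ℕ} {v : List Bool} : v ∈ binaryWords n ↔ v.length = n := by
  simp only [binaryWords, mem_image, mem_univ, true_and]
  constructor
  · rintro ⟨g, rfl⟩; simp
  · rintro rfl; exact ⟨v.get, List.ofFn_get v⟩

lemma card_binaryWords (n : ℕ) : #(binaryWords n) = 2 ^ n := by
  rw [binaryWords, card_image_of_injective _ List.ofFn_injective]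
  simp

/-- The `i`-th block of length `L` of the word `v`. -/
def wordBlock (L : ℕ) (v : List Bool) (i : ℕ) : List Bool := (v.drop (i * L)).take L

lemma blockConcat_wordBlock (L : ℕ) (v : List Bool) (m : ℕ) :
    blockConcat (wordBlock L v) m = v.take (m * L) := by
  induction m with
  | zero => simp [blockConcat]
  | succ m ih => rw [blockConcat, ih, wordBlock, add_mul, one_mul, List.take_add]

/-- Words with period `s` on the window of length `L` starting at position `p`. -/
noncomputable def periodicWords (n p L s : ℕ) : Finset (List Bool) :=
  (binaryWords n).filter fun v => ∀ j, j + s < L → v[p + j]? = v[p + j + s]?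

lemma card_periodicWords_le {n p L s : ℕ} (hs : 1 ≤ s) (hsL : s ≤ L) (hp : p + L ≤ n) :
    #(periodicWords n p L s) ≤ 2 ^ (n - L + s) := by
  rw [← card_binaryWords]
  refine card_le_card_of_injOn (fun v => v.take (p + s) ++ v.drop (p + L)) ?_ ?_
  · intro v hv
    have hv' := mem_binaryWords.1 (mem_filter.1 hv).1
    refine mem_coe.2 (mem_binaryWords.2 ?_)
    simp only [List.length_append, List.length_take, List.length_drop, hv']
    omega
  · intro v hv w hw h
    obtain ⟨hv1, hv2⟩ := mem_filter.1 hv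
    obtain ⟨hw1, hw2⟩ := mem_filter.1 hw
    rw [mem_binaryWords] at hv1 hw1
    obtain ⟨h1, h2⟩ := List.append_inj h (by simp [hv1, hw1])
    refine List.ext_getElem? fun x => ?_
    induction x using Nat.strong_induction_on with
    | _ x ih =>
      by_cases hx1 : x < p + s
      · have := congrArg (·[x]?) h1
        simpa [List.getElem?_take, hx1] using this
      by_cases hx2 : p + L ≤ x
      · have := congrArg (·[x - (p + L)]?) h2
        simpa [List.getElem?_drop, Nat.add_sub_cancel' hx2] using this
      have e : p + (x - p - s) + s = x := by omega
      have h3 := hv2 (x - p - s) (by omega)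
      have h4 := hw2 (x - p - s) (by omega)
      rw [e] at h3 h4
      rw [← h3, ← h4]
      exact ih _ (by omega)

/-- Words all of whose full blocks of length `L` are free of periods up to `K`. -/
noncomputable def aperiodicWords (n L K : ℕ) : Finset (List Bool) :=
  (binaryWords n).filter fun v => ∀ i, (i + 1) * L ≤ n → NoShortPeriod K (wordBlock L v i)

lemma two_pow_le_two_mul_card_aperiodicWords {n L K : ℕ} (hL : 1 ≤ L) (hLn : L ≤ n) (hKL : K ≤ L)
    (h : 2 * (n * K) * 2 ^ K ≤ 2 ^ L) : 2 ^ n ≤ 2 * #(aperiodicWords n L K) := by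
  set Q := ((range n).filter fun i => (i + 1) * L ≤ n) ×ˢ Icc 1 K with hQ
  have hsub : binaryWords n ⊆
      aperiodicWords n L K ∪ Q.biUnion fun q => periodicWords n (q.1 * L) L q.2 := by
    intro v hv
    by_cases hva : v ∈ aperiodicWords n L K
    · exact mem_union_left _ hva
    refine mem_union_right _ ?_
    have hva' : ¬ ∀ i, (i + 1) * L ≤ n → NoShortPeriod K (wordBlock L v i) := fun h' =>
      hva (mem_filter.2 ⟨hv, h'⟩)
    rw [mem_binaryWords] at hv
    simp only [NoShortPeriod] at hva'
    push Not at hva'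
    obtain ⟨i, hi, s, hs1, hsK, hper⟩ := hva'
    have hin : i < n := by nlinarith
    have hi' : i * L + L ≤ n := by rw [add_mul, one_mul] at hi; exact hi
    refine mem_biUnion.2 ⟨(i, s), ?_, ?_⟩
    · simp only [hQ, mem_product, mem_filter, mem_range, mem_Icc]
      exact ⟨⟨hin, hi⟩, hs1, hsK⟩
    · refine mem_filter.2 ⟨mem_binaryWords.2 hv, fun j hj => ?_⟩
      have hlen : (wordBlock L v i).length = L := by
        simp only [wordBlock, List.length_take, List.length_drop, hv]
        omega
      have h1 := hper j (by rw [hlen]; exact hj)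
      simp only [wordBlock, List.getElem?_take, List.getElem?_drop, hj,
        show j < L by omega, if_true] at h1
      rw [h1, add_assoc]
  have hcard := (card_le_card hsub).trans (card_union_le _ _)
  have hQc : #Q ≤ n * K := by
    rw [hQ, card_product, Nat.card_Icc, Nat.add_sub_cancel]
    exact Nat.mul_le_mul_right _ ((card_filter_le _ _).trans (by simp))
  have hbad : #(Q.biUnion fun q => periodicWords n (q.1 * L) L q.2) ≤
      n * K * 2 ^ (n - L + K) := by
    refine (card_biUnion_le_card_mul _ _ (2 ^ (n - L + K)) fun q hq => ?_).trans
      (Nat.mul_le_mul_right _ hQc)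
    simp only [hQ, mem_product, mem_filter, mem_range, mem_Icc] at hq
    obtain ⟨⟨-, hq1⟩, hq2, hq3⟩ := hq
    rw [add_mul, one_mul] at hq1
    refine (card_periodicWords_le hq2 (hq3.trans hKL) hq1).trans ?_
    exact Nat.pow_le_pow_right (by norm_num) (by omega)
  have hpow : 2 * (n * K * 2 ^ (n - L + K)) ≤ 2 ^ n := by
    calc 2 * (n * K * 2 ^ (n - L + K)) = 2 * (n * K) * 2 ^ K * 2 ^ (n - L) := by
          rw [pow_add]; ring
      _ ≤ 2 ^ L * 2 ^ (n - L) := Nat.mul_le_mul_right _ h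
      _ = 2 ^ n := by rw [← pow_add, Nat.add_sub_cancel' hLn]
  rw [card_binaryWords] at hcard
  omega

lemma lt_delDist_of_not_editClose {k n : ℕ} {u v : List Bool} (hu : u.length = n)
    (hv : v.length = n) (h : ¬ EditClose k u v) : k < delDist u v := by
  by_contra! hle
  have hne : {m : ℕ | ∃ w : List Bool, w.Sublist u ∧ w.Sublist v ∧ w.length = m}.Nonempty :=
    ⟨0, [], by simp⟩
  have hbdd : BddAbove {m : ℕ | ∃ w : List Bool, w.Sublist u ∧ w.Sublist v ∧ w.length = m} := by
    refine ⟨u.length, ?_⟩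
    rintro _ ⟨w, hw, -, rfl⟩
    exact hw.length_le
  obtain ⟨z, hz1, hz2, hz3⟩ := Nat.sSup_mem hne hbdd
  rw [← LCSlen] at hz3
  rw [delDist] at hle
  exact h ⟨z, hz1, hz2, by omega, by omega⟩

end Words

section Asymptotics

open Finset Classical

lemma exists_forall_log_pow_le (C q : ℕ) :
    ∃ N : ℕ, ∀ n ≥ N, (4 * Nat.log 2 n + C) ^ q ≤ n := by
  have h := (tendsto_pow_const_div_const_pow_of_one_lt q (r := (2 : ℝ)) (by norm_num)).eventually
    (gt_mem_nhds (show (0 : ℝ) < 1 / 5 ^ q by positivity))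
  obtain ⟨a₀, ha₀⟩ := Filter.eventually_atTop.1 h
  refine ⟨2 ^ (max a₀ C), fun n hn => ?_⟩
  have hn0 : n ≠ 0 := by
    have : 0 < 2 ^ (max a₀ C) := by positivity
    omega
  have ha : max a₀ C ≤ Nat.log 2 n := Nat.le_log_of_pow_le (by norm_num) hn
  have h1 := ha₀ _ ((le_max_left _ _).trans ha)
  rw [div_lt_div_iff₀ (by positivity) (by positivity), one_mul, ← mul_pow] at h1
  have h2 : (Nat.log 2 n * 5) ^ q < 2 ^ Nat.log 2 n := by exact_mod_cast h1
  calc (4 * Nat.log 2 n + C) ^ q ≤ (Nat.log 2 n * 5) ^ q := by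
        gcongr
        have := (le_max_right a₀ C).trans ha
        omega
    _ ≤ 2 ^ Nat.log 2 n := h2.le
    _ ≤ n := Nat.pow_log_le_self 2 hn0

/-- A graph of degree at most `(6 n) ^ (2 k)` whose neighbourhoods have few edges has an
independent set larger by a factor of order `log n` than the greedy bound. -/
lemma exists_indepSet_of_card_neighbours_le {α : Type*} [DecidableEq α] {r : α → α → Prop}
    {k n Y : ℕ} (hk : 1 ≤ k) (hn : 1 ≤ n) (hlog : 32 ≤ Real.log n) (hY : Y ^ 2 ≤ n)
    (hsymm : ∀ a b, r a b → r b a) (hirr : ∀ a, ¬ r a a) {V : Finset α}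
    (hdeg : ∀ v ∈ V, #(V.filter (r v)) ≤ (6 * n) ^ (2 * k))
    (hloc : ∀ v ∈ V, ∑ u ∈ V.filter (r v), #((V.filter (r v)).filter (r u)) ≤
      n ^ (4 * k - 1) * Y) :
    ∃ W ⊆ V, (∀ a ∈ W, ∀ b ∈ W, ¬ r a b) ∧
      Real.log n * #V ≤ 128 * 36 ^ k * (n : ℝ) ^ (2 * k) * #W := by
  have hn0 : (0 : ℝ) < n := by positivity
  obtain ⟨x, hx0, hx8⟩ : ∃ x : ℝ, 0 < x ∧ x ^ 8 = n :=
    ⟨(n : ℝ) ^ ((8 : ℕ) : ℝ)⁻¹, by positivity, Real.rpow_inv_natCast_pow hn0.le (by norm_num)⟩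
  have hlogx : Real.log n = 8 * Real.log x := by
    rw [← hx8, Real.log_pow]; norm_num
  have hlx : Real.log x ≤ x - 1 := Real.log_le_sub_one_of_pos hx0
  have hx5 : 5 ≤ x := by linarith
  have hnk : (n : ℝ) ≤ n ^ (2 * k) :=
    le_self_pow₀ (by exact_mod_cast (by omega : 1 ≤ n)) (by omega)
  set D : ℝ := (n : ℝ) ^ (2 * k) with hD
  have hD0 : 0 < D := by positivity
  have hx2D : 2 * x ^ 2 ≤ D := by
    refine le_trans ?_ hnk
    rw [← hx8]
    have h6 : (2 : ℝ) ≤ x ^ 6 :=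
      (by linarith : (2 : ℝ) ≤ x).trans (le_self_pow₀ (by linarith) (by norm_num))
    calc 2 * x ^ 2 ≤ x ^ 6 * x ^ 2 := by gcongr
      _ = x ^ 8 := by ring
  set t : ℝ := x ^ 2 / D with ht
  have ht0 : 0 ≤ t := by positivity
  have hY' : (Y : ℝ) ≤ x ^ 4 := by
    refine le_of_sq_le_sq ?_ (by positivity)
    rw [← pow_mul, hx8]
    exact_mod_cast hY
  refine Exists.imp ?_ (exists_indepSet_of_locally_sparse (r := r) (t := t)
    (Δ := 36 ^ k * D) (E := (n : ℝ) ^ (4 * k - 1) * x ^ 4) (B := x) (T := Real.log n / 64)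
    (V := V) ht0 ?_ ?_ ?_ ?_ hx0 (by positivity) (by positivity) ?_ ?_ ?_ ?_)
  · rintro W ⟨hWV, hWi, hWc⟩
    exact ⟨hWV, hWi, by linarith⟩
  · rw [ht, div_le_iff₀ hD0]; linarith
  · exact hsymm
  · exact hirr
  · have e : D ^ 2 = n * (n : ℝ) ^ (4 * k - 1) := by
      rw [hD, ← pow_mul, ← pow_succ']
      congr 1
      omega
    rw [ht, div_pow, div_mul_eq_mul_div, div_le_one (by positivity), e]
    refine le_of_eq ?_
    rw [← hx8]
    ring
  · linarith
  · have e : 36 ^ k * D * t = 36 ^ k * x ^ 2 := by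
      rw [ht]; field_simp
    have ht1 : t ≤ x := by
      rw [ht, div_le_iff₀ hD0]; nlinarith
    have h36 : (1 : ℝ) ≤ 36 ^ k := one_le_pow₀ (by norm_num)
    have hlx0 : 0 ≤ Real.log x := by linarith
    rw [e, hlogx]
    nlinarith [mul_nonneg hlx0 hx0.le, sq_nonneg x]
  · intro v hv
    have h := hdeg v hv
    have e : (36 ^ k * D : ℝ) = (((6 * n) ^ (2 * k) : ℕ) : ℝ) := by
      push_cast
      rw [mul_pow, hD, pow_mul 6]
      norm_num
    rw [e]
    exact_mod_cast h
  · intro v hv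
    have h : ((∑ u ∈ V.filter (r v), #((V.filter (r v)).filter (r u)) : ℕ) : ℝ) ≤
        ((n ^ (4 * k - 1) * Y : ℕ) : ℝ) := by
      exact_mod_cast hloc v hv
    rw [Nat.cast_sum, Nat.cast_mul, Nat.cast_pow] at h
    exact h.trans (by gcongr)

/-- The lower bound for all lengths that are large in terms of `k`. -/
lemma exists_code_of_large {k n : ℕ} (hk : 2 ≤ k) (hkn : k ≤ n)
    (h1 : 2 * (6 * k) * 2 ^ (6 * k) ≤ n) (h2 : 32 ≤ Real.log n)
    (h3 : (4 * Nat.log 2 n + (2 * k + 7)) ^ (160 * k ^ 2) ≤ n) :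
    ∃ C : Finset (List Bool), (∀ u ∈ C, u.length = n) ∧
      (∀ u ∈ C, ∀ v ∈ C, u ≠ v → k < delDist u v) ∧
      Real.log n * 2 ^ n ≤ 256 * 36 ^ k * (n : ℝ) ^ (2 * k) * #C := by
  set a := Nat.log 2 n with ha
  set L := 2 * (a + 1) with hL
  set Z := 4 * a + (2 * k + 7) with hZ
  set m := n / L + 1 with hm
  set X := Z ^ (2 * k) with hX
  have hZ1 : 1 ≤ Z := by omega
  have hn2 : 2 ≤ n := hk.trans hkn
  have hn2L : n ^ 2 ≤ 2 ^ L := by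
    rw [hL, mul_comm, pow_mul]
    gcongr
    exact (Nat.lt_pow_succ_log_self (by norm_num) n).le
  have hZn : Z ^ 2 ≤ n := (Nat.pow_le_pow_right hZ1 (by nlinarith)).trans h3
  have hKL : 6 * k ≤ L := by
    have : 6 * k ≤ a := Nat.le_log_of_pow_le (by norm_num)
      ((Nat.le_mul_of_pos_left _ (by omega)).trans h1)
    omega
  have hLn : L ≤ n := by nlinarith
  have hkm : 4 * k ≤ m := by
    have : 4 * k ≤ n / L := by
      rw [Nat.le_div_iff_mul_le (by omega)]
      nlinarith
    omega
  have hmn : m ≤ n := by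
    have : n / L ≤ n / 2 := Nat.div_le_div_left (by omega) (by norm_num)
    omega
  have hV := two_pow_le_two_mul_card_aperiodicWords (n := n) (L := L) (K := 6 * k) (by omega) hLn
    hKL (by
      calc 2 * (n * (6 * k)) * 2 ^ (6 * k) = n * (2 * (6 * k) * 2 ^ (6 * k)) := by ring
        _ ≤ n * n := Nat.mul_le_mul_left _ h1
        _ = n ^ 2 := (sq n).symm
        _ ≤ 2 ^ L := hn2L)
  set V := aperiodicWords n L (6 * k) with hVdef
  have hlen : ∀ v ∈ V, v.length = n := fun v hv => mem_binaryWords.1 (mem_filter.1 hv).1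
  obtain ⟨r, hr⟩ : ∃ r : List Bool → List Bool → Prop,
      ∀ u v, r u v ↔ u ≠ v ∧ EditClose k u v := ⟨_, fun _ _ => Iff.rfl⟩
  have hloc : ∀ v ∈ V, ∑ u ∈ V.filter (r v), #((V.filter (r v)).filter (r u)) ≤
      n ^ (4 * k - 1) * (X ^ (20 * k) * X ^ (20 * k)) := by
    intro v hv
    have hcat : blockConcat (wordBlock L v) m = v := by
      rw [blockConcat_wordBlock, List.take_of_length_le]
      rw [hlen v hv, hm, add_mul, one_mul]
      have := Nat.div_add_mod n L
      have := Nat.mod_lt n (show L > 0 by omega)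
      nlinarith
    refine (sum_card_common_neighbours_le (m := m) (f := wordBlock L v) (r := r) (by omega) hkm
      (X := X) (Nat.one_le_pow _ _ hZ1) (fun i hi => ?_) (fun i => ?_) (fun u hu => ?_)
      (fun u w h => ((hr u w).1 h).2)).trans ?_
    · refine (mem_filter.1 hv).2 i ?_
      have : i + 1 ≤ n / L := by omega
      exact (Nat.mul_le_mul_right L this).trans (Nat.div_mul_le_self n L)
    · refine (card_editBall_le k _).trans (Nat.pow_le_pow_left ?_ _)
      have : (wordBlock L v i).length ≤ L := by simp [wordBlock]
      omega
    · rw [hcat]; exact ((hr _ _).1 (mem_filter.1 hu).2).2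
    · gcongr
  have hdeg : ∀ v ∈ V, #(V.filter (r v)) ≤ (6 * n) ^ (2 * k) := by
    intro v hv
    refine (card_le_card fun u hu => ((hr _ _).1 (mem_filter.1 hu).2).2.mem_editBall).trans
      ((card_editBall_le k v).trans (Nat.pow_le_pow_left ?_ _))
    rw [hlen v hv]
    omega
  have hX2 : (X ^ (20 * k) * X ^ (20 * k)) ^ 2 = Z ^ (160 * k ^ 2) := by
    rw [hX, ← pow_mul, ← pow_add, ← pow_mul]
    congr 1
    ring
  obtain ⟨W, hWV, hWi, hWc⟩ := exists_indepSet_of_card_neighbours_le (r := r) (V := V) (k := k)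
    (Y := X ^ (20 * k) * X ^ (20 * k)) (by omega) (by omega) h2 (hX2.trans_le h3)
    (fun u v h => (hr v u).2 (((hr u v).1 h).imp Ne.symm EditClose.symm))
    (fun u h => ((hr u u).1 h).1 rfl) hdeg hloc
  refine ⟨W, fun u hu => hlen u (hWV hu), fun u hu v hv huv =>
    lt_delDist_of_not_editClose (hlen u (hWV hu)) (hlen v (hWV hv)) fun h =>
      hWi u hu v hv ((hr u v).2 ⟨huv, h⟩), ?_⟩
  have hV' : (2 : ℝ) ^ n ≤ 2 * #V := by exact_mod_cast hV
  have : Real.log n * 2 ^ n ≤ Real.log n * (2 * #V) := by gcongr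
  linarith

end Asymptotics

theorem stmt0 (k : ℕ) (hk : 2 ≤ k) :
    ∃ c : ℝ, 0 < c ∧ ∀ n : ℕ, k ≤ n →
      ∃ C : Finset (List Bool),
        (∀ u ∈ C, u.length = n) ∧
        (∀ u ∈ C, ∀ v ∈ C, u ≠ v → k < delDist u v) ∧
        c * 2 ^ n * Real.logb 2 n / (n : ℝ) ^ (2 * k) ≤ (C.card : ℝ) := by
  obtain ⟨N₁, hN₁⟩ := exists_forall_log_pow_le (2 * k + 7) (160 * k ^ 2)
  obtain ⟨N₂, hN₂⟩ := Filter.eventually_atTop.1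
    ((Real.tendsto_log_atTop.comp tendsto_natCast_atTop_atTop).eventually_ge_atTop 32)
  set N := max (max N₁ N₂) (2 * (6 * k) * 2 ^ (6 * k)) with hN
  refine ⟨min (1 / (512 * 36 ^ k)) (1 / (2 ^ N * (N + 1))), by positivity, fun n hkn => ?_⟩
  have hn1 : (1 : ℝ) ≤ n := by exact_mod_cast (by omega : 1 ≤ n)
  have hlogb : 0 ≤ Real.logb 2 n := Real.logb_nonneg (by norm_num) hn1
  rcases le_total N n with hn | hn
  · obtain ⟨C, hC1, hC2, hC3⟩ := exists_code_of_large hk hkn ((le_max_right _ _).trans hn)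
      (hN₂ n (((le_max_right _ _).trans (le_max_left _ _)).trans hn))
      (hN₁ n (((le_max_left _ _).trans (le_max_left _ _)).trans hn))
    refine ⟨C, hC1, hC2, ?_⟩
    rw [div_le_iff₀ (by positivity)]
    have hlog : Real.logb 2 n ≤ 2 * Real.log n := by
      rw [Real.logb, div_le_iff₀ (Real.log_pos (by norm_num))]
      have := Real.log_two_gt_d9
      have := Real.log_nonneg hn1
      nlinarith
    calc min (1 / (512 * 36 ^ k)) (1 / (2 ^ N * (N + 1) : ℝ)) * 2 ^ n * Real.logb 2 n
        ≤ 1 / (512 * 36 ^ k) * 2 ^ n * (2 * Real.log n) := by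
          gcongr
          exact min_le_left _ _
      _ = 1 / (256 * 36 ^ k) * (Real.log n * 2 ^ n) := by ring
      _ ≤ 1 / (256 * 36 ^ k) * (256 * 36 ^ k * (n : ℝ) ^ (2 * k) * C.card) := by gcongr
      _ = C.card * (n : ℝ) ^ (2 * k) := by field_simp
  · refine ⟨{List.replicate n true}, by simp, by simp, ?_⟩
    have hlog : Real.logb 2 n ≤ N + 1 := by
      have h1 : Real.logb 2 n ≤ n := by
        rw [Real.logb_le_iff_le_rpow (by norm_num) (by linarith), Real.rpow_natCast]
        exact_mod_cast Nat.lt_two_pow_self.le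
      have h2 : (n : ℝ) ≤ N := by exact_mod_cast hn
      linarith
    rw [Finset.card_singleton, Nat.cast_one]
    refine div_le_one_of_le₀ ?_ (by positivity)
    calc min (1 / (512 * 36 ^ k)) (1 / (2 ^ N * (N + 1) : ℝ)) * 2 ^ n * Real.logb 2 n
        ≤ 1 / (2 ^ N * (N + 1) : ℝ) * 2 ^ N * (N + 1) := by
          gcongr
          · exact min_le_right _ _
          · norm_num
      _ = 1 := by field_simp
      _ ≤ (n : ℝ) ^ (2 * k) := one_le_pow₀ hn1
end

section
/- For all integers a ≥ b ≥ c ≥ 1 there exists a constant C > 0 (depending only on a) such that for every integer n ≥ 2, the number of ordered triples (u, v, w) ∈ ({0,1}^n)³ with d(u,v) ≤ a, d(v,w) ≤ b, and d(w,u) ≤ c is at most C · 2^n · n^(a+b+c) · (log₂ n)^(b+c−a), where the exponent b + c − a is an integer that may be negative and the power of log₂ n is taken in the reals. -/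
section

open Finset

/-- The number of entries of `y` that are smaller than `t`. -/
def countBelow {ι : Type*} [Fintype ι] {N : ℕ} (y : ι → Fin N) (t : ℕ) : ℕ :=
  ∑ x, if (y x : ℕ) < t then 1 else 0

/-- `i` and `j` are corresponding positions once the entries of `y` are deleted from a first word
of length `n` and the entries of `z` from a second one. -/
def EditMatch {α β : Type*} [Fintype α] [Fintype β] {n : ℕ}
    (y : α → Fin (n + 1)) (z : β → Fin (n + 1)) (i j : ℕ) : Prop :=
  i < n ∧ j < n ∧ (∀ x, (y x : ℕ) ≠ i) ∧ (∀ x, (z x : ℕ) ≠ j) ∧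
    i + countBelow z j = j + countBelow y i

open Classical in
/-- A strictly monotone relation on `{0, …, n - 1}` that leaves at most `r` points unmatched on
either side. -/
structure NearMatching (n r : ℕ) (R : ℕ → ℕ → Prop) : Prop where
  left_lt : ∀ {i j}, R i j → i < n
  right_lt : ∀ {i j}, R i j → j < n
  mono : ∀ {i j i' j'}, R i j → R i' j' → (i < i' ↔ j < j')
  left_miss : #{i ∈ range n | ¬ ∃ j, R i j} ≤ r
  right_miss : #{j ∈ range n | ¬ ∃ i, R i j} ≤ r

theorem NearMatching.flip {n r : ℕ} {R : ℕ → ℕ → Prop} (h : NearMatching n r R) :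
    NearMatching n r (fun j i => R i j) where
  left_lt := h.right_lt
  right_lt := h.left_lt
  mono h₁ h₂ := (h.mono h₁ h₂).symm
  left_miss := h.right_miss
  right_miss := h.left_miss

open Classical in
theorem NearMatching.card_left_miss_comp {n r s : ℕ} {R S : ℕ → ℕ → Prop}
    (hR : NearMatching n r R) (hS : NearMatching n s S) :
    #{i ∈ range n | ¬ ∃ k, Relation.Comp R S i k} ≤ r + s := by
  let inv : ℕ → ℕ := fun j => if h : ∃ i, R i j then h.choose else 0
  have hinv : ∀ i j, R i j → inv j = i := by
    intro i j hij
    have h : ∃ i, R i j := ⟨i, hij⟩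
    have h1 : inv j = h.choose := dif_pos h
    rw [h1]
    have h2 := hR.mono h.choose_spec hij
    have h3 := hR.mono hij h.choose_spec
    omega
  calc #{i ∈ range n | ¬ ∃ k, Relation.Comp R S i k}
      ≤ #({i ∈ range n | ¬ ∃ j, R i j} ∪ ({j ∈ range n | ¬ ∃ k, S j k}).image inv) := by
        apply card_le_card
        intro i hi
        simp only [mem_filter, mem_union, mem_image, mem_range] at hi ⊢
        by_cases h : ∃ j, R i j
        · obtain ⟨j, hj⟩ := h
          exact Or.inr ⟨j, ⟨hR.right_lt hj, fun ⟨k, hk⟩ => hi.2 ⟨k, j, hj, hk⟩⟩, hinv i j hj⟩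
        · exact Or.inl ⟨hi.1, h⟩
    _ ≤ r + s := (card_union_le _ _).trans
        (add_le_add hR.left_miss (card_image_le.trans hS.left_miss))

theorem NearMatching.comp {n r s : ℕ} {R S : ℕ → ℕ → Prop}
    (hR : NearMatching n r R) (hS : NearMatching n s S) :
    NearMatching n (r + s) (Relation.Comp R S) where
  left_lt := fun ⟨_, h, _⟩ => hR.left_lt h
  right_lt := fun ⟨_, _, h⟩ => hS.right_lt h
  mono := fun ⟨_, h₁, h₂⟩ ⟨_, h₃, h₄⟩ => (hR.mono h₁ h₃).trans (hS.mono h₂ h₄)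
  left_miss := hR.card_left_miss_comp hS
  right_miss := by
    have := hS.flip.card_left_miss_comp hR.flip
    rw [add_comm r s]
    convert this using 5
    simp only [Relation.Comp, and_comm]

/-- A word that is constant along a near matching is determined by its letters at the fixed points
and the unmatched points. -/
theorem NearMatching.eq_of_eq_on {n r : ℕ} {R : ℕ → ℕ → Prop} (hR : NearMatching n r R)
    {α : Type*} {f g : ℕ → α} (hf : ∀ i j, R i j → f i = f j) (hg : ∀ i j, R i j → g i = g j)
    (hfix : ∀ i, R i i → f i = g i) (hleft : ∀ i < n, (¬ ∃ j, R i j) → f i = g i)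
    (hright : ∀ j < n, (¬ ∃ i, R i j) → f j = g j) : ∀ i < n, f i = g i := by
  intro i
  induction i using Nat.strong_induction_on with
  | _ t ih =>
    intro ht
    by_cases h₁ : ∃ j, R t j
    swap
    · exact hleft t ht h₁
    by_cases h₂ : ∃ j, R j t
    swap
    · exact hright t ht h₂
    obtain ⟨j, hj⟩ := h₁
    obtain ⟨k, hk⟩ := h₂
    rcases lt_trichotomy j t with h | h | h
    · rw [hf t j hj, hg t j hj]
      exact ih j h (hR.right_lt hj)
    · subst h
      exact hfix _ hj
    · have hkt : k < t := (hR.mono hk hj).2 h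
      rw [← hf k t hk, ← hg k t hk]
      exact ih k hkt (hR.left_lt hk)

/-- Pads a finite set of positions below `n` with copies of `n`. -/
theorem exists_padded_enumeration {n : ℕ} (D : Finset ℕ) (hD : D ⊆ range n) {a : ℕ}
    (ha : #D ≤ a) :
    ∃ y : Fin a → Fin (n + 1), (∀ i < n, (∃ x, (y x : ℕ) = i) ↔ i ∈ D) ∧
      ∀ i ≤ n, countBelow y i = #{d ∈ D | d < i} := by
  induction D using Finset.induction_on generalizing a with
  | empty =>
    refine ⟨fun _ => Fin.last n, fun i hi => ?_, fun i hi => ?_⟩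
    · simp only [Fin.val_last, notMem_empty, iff_false]
      rintro ⟨_, h⟩
      omega
    · simp [countBelow, hi]
  | insert d D hd ih =>
    rw [card_insert_of_notMem hd] at ha
    obtain ⟨a, rfl⟩ : ∃ a', a = a' + 1 := ⟨a - 1, by omega⟩
    obtain ⟨y, hy₁, hy₂⟩ := ih ((subset_insert d D).trans hD) (a := a) (by omega)
    have hdn : d < n := mem_range.1 (hD (mem_insert_self d D))
    refine ⟨Fin.cons ⟨d, by omega⟩ y, fun i hi => ?_, fun i hi => ?_⟩
    · rw [mem_insert, ← hy₁ i hi, Fin.exists_fin_succ]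
      simp [eq_comm]
    · have := hy₂ i hi
      simp only [countBelow] at this
      rw [countBelow, Fin.sum_univ_succ]
      simp only [Fin.cons_zero, Fin.cons_succ, this]
      rw [filter_insert]
      split_ifs with h
      · rw [card_insert_of_notMem (by simp [hd]), add_comm]
      · simp

theorem exists_deleted_positions {n a : ℕ} {s u : List Bool} (h : s.Sublist u)
    (hu : u.length = n) (ha : n ≤ s.length + a) :
    ∃ (y : Fin a → Fin (n + 1)) (f : ℕ → ℕ), StrictMono f ∧
      (∀ k, s.getD k false = u.getD (f k) false) ∧ (∀ k, f k < n ↔ k < s.length) ∧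
      (∀ i < n, (∀ x, (y x : ℕ) ≠ i) ↔ ∃ k, f k = i) ∧
      ∀ k, f k < n → f k = k + countBelow y (f k) := by
  classical
  obtain ⟨f, hf⟩ := List.sublist_iff_exists_orderEmbedding_getElem?_eq.1 h
  have hlt : ∀ k, f k < n ↔ k < s.length := by
    intro k
    rw [← not_iff_not, not_lt, not_lt, ← hu, ← List.getElem?_eq_none_iff,
      ← List.getElem?_eq_none_iff, hf k]
  have hcard : ∀ k, f k ≤ n →
      #{d ∈ {i ∈ range n | ¬ ∃ k, f k = i} | d < f k} + k = f k := by
    intro k hk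
    have h₁ : (range k).image f = {i ∈ range (f k) | ∃ k, f k = i} := by
      ext i
      simp only [mem_image, mem_range, mem_filter]
      constructor
      · rintro ⟨j, hj, rfl⟩
        exact ⟨f.strictMono hj, j, rfl⟩
      · rintro ⟨hi, j, rfl⟩
        exact ⟨j, f.strictMono.lt_iff_lt.1 hi, rfl⟩
    have h₂ : {d ∈ {i ∈ range n | ¬ ∃ k, f k = i} | d < f k} =
        {i ∈ range (f k) | ¬ ∃ k, f k = i} := by
      ext i
      simp only [mem_filter, mem_range]
      constructor
      · rintro ⟨⟨-, h⟩, h'⟩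
        exact ⟨h', h⟩
      · rintro ⟨h', h⟩
        exact ⟨⟨by omega, h⟩, h'⟩
    have h₃ : #((range k).image f) = k := by
      rw [card_image_of_injective _ f.injective, card_range]
    have h₄ := card_filter_add_card_filter_not (s := range (f k)) (fun i => ∃ k, f k = i)
    rw [h₁] at h₃
    rw [card_range] at h₄
    rw [h₂]
    omega
  obtain ⟨y, hy₁, hy₂⟩ := exists_padded_enumeration (n := n) (a := a)
    {i ∈ range n | ¬ ∃ k, f k = i} (filter_subset _ _) (by
      have h₁ : (range s.length).image f ⊆ {i ∈ range n | ∃ k, f k = i} := by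
        intro i
        simp only [mem_image, mem_range, mem_filter]
        rintro ⟨j, hj, rfl⟩
        exact ⟨(hlt j).2 hj, j, rfl⟩
      have h₂ := card_le_card h₁
      rw [card_image_of_injective _ f.injective, card_range] at h₂
      have h₄ := card_filter_add_card_filter_not (s := range n) (fun i => ∃ k, f k = i)
      rw [card_range] at h₄
      omega)
  refine ⟨y, f, f.strictMono, fun k => ?_, hlt, fun i hi => ?_, fun k hk => ?_⟩
  · rw [List.getD_eq_getElem?_getD, List.getD_eq_getElem?_getD, hf k]
  · rw [← not_iff_not]
    push Not
    rw [hy₁ i hi]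
    simp [hi]
  · rw [hy₂ _ hk.le]
    have := hcard k hk.le
    omega

/-- Two words with a long common subsequence are aligned by a near matching. -/
theorem exists_alignment {n a : ℕ} {s u v : List Bool} (hu : u.length = n) (hv : v.length = n)
    (hsu : s.Sublist u) (hsv : s.Sublist v) (hs : n ≤ s.length + a) :
    ∃ y z : Fin a → Fin (n + 1), NearMatching n a (EditMatch y z) ∧
      ∀ i j, EditMatch y z i j → u.getD i false = v.getD j false := by
  classical
  obtain ⟨y, f, hf, hfu, hflt, hfy, hfc⟩ := exists_deleted_positions hsu hu hs
  obtain ⟨z, g, hg, hgv, hglt, hgz, hgc⟩ := exists_deleted_positions hsv hv hs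
  have key : ∀ i j, EditMatch y z i j ↔ ∃ k < s.length, f k = i ∧ g k = j := by
    intro i j
    constructor
    · rintro ⟨hi, hj, hyi, hzj, hij⟩
      obtain ⟨k, rfl⟩ := (hfy i hi).1 hyi
      obtain ⟨l, rfl⟩ := (hgz j hj).1 hzj
      have h₁ := hfc k hi
      have h₂ := hgc l hj
      obtain rfl : k = l := by omega
      exact ⟨k, (hflt k).1 hi, rfl, rfl⟩
    · rintro ⟨k, hk, rfl, rfl⟩
      have hi := (hflt k).2 hk
      have hj := (hglt k).2 hk
      have h₁ := hfc k hi
      have h₂ := hgc k hj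
      exact ⟨hi, hj, (hfy _ hi).2 ⟨k, rfl⟩, (hgz _ hj).2 ⟨k, rfl⟩, by omega⟩
  have miss : ∀ y : Fin a → Fin (n + 1), #(univ.image fun x => (y x : ℕ)) ≤ a := fun y =>
    card_image_le.trans (by simp)
  refine ⟨y, z, ⟨fun h => h.1, fun h => h.2.1, ?_, ?_, ?_⟩, ?_⟩
  · intro i j i' j' h h'
    obtain ⟨k, -, rfl, rfl⟩ := (key _ _).1 h
    obtain ⟨k', -, rfl, rfl⟩ := (key _ _).1 h'
    rw [hf.lt_iff_lt, hg.lt_iff_lt]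
  · refine (card_le_card fun i hi => ?_).trans (miss y)
    simp only [mem_filter, mem_range] at hi
    by_contra h
    simp only [mem_image, mem_univ, true_and, not_exists] at h
    obtain ⟨k, rfl⟩ := (hfy i hi.1).1 h
    exact hi.2 ⟨g k, (key _ _).2 ⟨k, (hflt k).1 hi.1, rfl, rfl⟩⟩
  · refine (card_le_card fun i hi => ?_).trans (miss z)
    simp only [mem_filter, mem_range] at hi
    by_contra h
    simp only [mem_image, mem_univ, true_and, not_exists] at h
    obtain ⟨k, rfl⟩ := (hgz i hi.1).1 h
    exact hi.2 ⟨f k, (key _ _).2 ⟨k, (hglt k).1 hi.1, rfl, rfl⟩⟩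
  · intro i j h
    obtain ⟨k, -, rfl, rfl⟩ := (key _ _).1 h
    rw [← hfu, ← hgv]

theorem countBelow_le {ι : Type*} [Fintype ι] {N : ℕ} (y : ι → Fin N) (t : ℕ) :
    countBelow y t ≤ Fintype.card ι := by
  rw [countBelow, sum_boole, Nat.cast_id]
  exact card_le_univ _

theorem countBelow_congr {ι : Type*} [Fintype ι] {N M i t : ℕ} {y : ι → Fin N}
    (hy : ∀ x, t + M < y x ∨ y x + M < t) (h₁ : i ≤ t + M) (h₂ : t ≤ i + M) :
    countBelow y i = countBelow y t := by
  refine sum_congr rfl fun x _ => ?_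
  have := hy x
  split_ifs <;> omega

/-- Labels for the edits between three words at pairwise deletion distances `a`, `b`, `c`. -/
abbrev EditIndex (a b c : ℕ) : Type := (Fin a ⊕ Fin a) ⊕ (Fin b ⊕ Fin b) ⊕ (Fin c ⊕ Fin c)

/-- The matching of two words whose edits are listed by `y`. -/
abbrev editRel {α β : Type*} [Fintype α] [Fintype β] {n : ℕ} (y : α ⊕ β → Fin (n + 1)) :
    ℕ → ℕ → Prop :=
  EditMatch (y ∘ Sum.inl) (y ∘ Sum.inr)

/-- The composite matching of the third word with itself through the first and the second. -/
def roundTrip {n a b c : ℕ} (e : EditIndex a b c → Fin (n + 1)) : ℕ → ℕ → Prop :=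
  Relation.Comp (Relation.Comp (editRel (e ∘ Sum.inr ∘ Sum.inr)) (editRel (e ∘ Sum.inl)))
    (editRel (e ∘ Sum.inr ∘ Sum.inl))

open Classical in
/-- The positions fixed by the composite matching. -/
noncomputable def fixedPositions {n a b c : ℕ} (e : EditIndex a b c → Fin (n + 1)) : Finset ℕ :=
  {t ∈ range n | roundTrip e t t}

theorem even_countBelow_of_roundTrip {n a b c t : ℕ} {e : EditIndex a b c → Fin (n + 1)}
    (h : roundTrip e t t) (he : ∀ x, t + (a + b + c) < e x ∨ e x + (a + b + c) < t) :
    Even (countBelow e t) := by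
  obtain ⟨j, ⟨i, ⟨-, -, -, -, h₃⟩, ⟨-, -, -, -, h₁⟩⟩, ⟨-, -, -, -, h₂⟩⟩ := h
  have hsum : countBelow e t =
      (countBelow ((e ∘ Sum.inl) ∘ Sum.inl) t + countBelow ((e ∘ Sum.inl) ∘ Sum.inr) t) +
      ((countBelow ((e ∘ Sum.inr ∘ Sum.inl) ∘ Sum.inl) t +
        countBelow ((e ∘ Sum.inr ∘ Sum.inl) ∘ Sum.inr) t) +
      (countBelow ((e ∘ Sum.inr ∘ Sum.inr) ∘ Sum.inl) t +
        countBelow ((e ∘ Sum.inr ∘ Sum.inr) ∘ Sum.inr) t)) := by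
    simp only [countBelow, Fintype.sum_sum_type, Function.comp]
  have b₁ := countBelow_le ((e ∘ Sum.inr ∘ Sum.inr) ∘ Sum.inl) t
  have b₂ := countBelow_le ((e ∘ Sum.inr ∘ Sum.inr) ∘ Sum.inr) i
  have b₃ := countBelow_le ((e ∘ Sum.inr ∘ Sum.inl) ∘ Sum.inl) j
  have b₄ := countBelow_le ((e ∘ Sum.inr ∘ Sum.inl) ∘ Sum.inr) t
  rw [Fintype.card_fin] at b₁ b₂ b₃ b₄
  have c₁ : countBelow ((e ∘ Sum.inl) ∘ Sum.inl) i = countBelow ((e ∘ Sum.inl) ∘ Sum.inl) t :=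
    countBelow_congr (fun x => he _) (by omega) (by omega)
  have c₂ : countBelow ((e ∘ Sum.inl) ∘ Sum.inr) j = countBelow ((e ∘ Sum.inl) ∘ Sum.inr) t :=
    countBelow_congr (fun x => he _) (by omega) (by omega)
  have c₃ : countBelow ((e ∘ Sum.inr ∘ Sum.inl) ∘ Sum.inl) j =
      countBelow ((e ∘ Sum.inr ∘ Sum.inl) ∘ Sum.inl) t :=
    countBelow_congr (fun x => he _) (by omega) (by omega)
  have c₄ : countBelow ((e ∘ Sum.inr ∘ Sum.inr) ∘ Sum.inr) i =
      countBelow ((e ∘ Sum.inr ∘ Sum.inr) ∘ Sum.inr) t :=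
    countBelow_congr (fun x => he _) (by omega) (by omega)
  rw [hsum, Nat.even_iff]
  omega

/-- An edit-free interval preceded by an odd number of edits contains few fixed positions. -/
theorem gap_le_of_odd_countBelow {n a b c p q : ℕ} {e : EditIndex a b c → Fin (n + 1)}
    (hq : q ≤ n) (hodd : ∀ t, p < t → t ≤ q → Odd (countBelow e t))
    (he : ∀ x, (e x : ℕ) ≤ p ∨ q ≤ e x) :
    q ≤ p + (n - #(fixedPositions e) + 2 * (a + b + c) + 1) := by
  classical
  have hsub : Ioo (p + (a + b + c)) (q - (a + b + c)) ⊆ range n \ fixedPositions e := by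
    intro t ht
    rw [mem_Ioo] at ht
    rw [mem_sdiff, mem_range]
    refine ⟨by omega, fun hF => ?_⟩
    have hev := even_countBelow_of_roundTrip (mem_filter.1 hF).2 (fun x => by
      have := he x
      omega)
    exact Nat.not_even_iff_odd.2 (hodd t (by omega) (by omega)) hev
  have hcard := card_le_card hsub
  rw [Nat.card_Ioo, card_sdiff_of_subset (s := fixedPositions e) (filter_subset _ _),
    card_range] at hcard
  omega

theorem sorted_gap_le {n a b c m : ℕ} (ψ : Fin (2 * m) ≃ EditIndex a b c)
    (e : EditIndex a b c → Fin (n + 1)) (i : ℕ) (hi : i < m) :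
    (e (ψ (Tuple.sort (e ∘ ψ) ⟨2 * i + 1, by omega⟩)) : ℕ) ≤
      e (ψ (Tuple.sort (e ∘ ψ) ⟨2 * i, by omega⟩)) +
        (n - #(fixedPositions e) + 2 * (a + b + c) + 1) := by
  have hmono : ∀ j k : Fin (2 * m), j ≤ k →
      (e (ψ (Tuple.sort (e ∘ ψ) j)) : ℕ) ≤ e (ψ (Tuple.sort (e ∘ ψ) k)) :=
    fun j k hjk => Tuple.monotone_sort (e ∘ ψ) hjk
  have hlow : ∀ j : Fin (2 * m), (j : ℕ) ≤ 2 * i →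
      (e (ψ (Tuple.sort (e ∘ ψ) j)) : ℕ) ≤ e (ψ (Tuple.sort (e ∘ ψ) ⟨2 * i, by omega⟩)) :=
    fun j hj => hmono _ _ (Fin.mk_le_mk.2 hj)
  have hhigh : ∀ j : Fin (2 * m), 2 * i < (j : ℕ) →
      (e (ψ (Tuple.sort (e ∘ ψ) ⟨2 * i + 1, by omega⟩)) : ℕ) ≤ e (ψ (Tuple.sort (e ∘ ψ) j)) :=
    fun j hj => hmono _ _ (Fin.mk_le_mk.2 hj)
  refine gap_le_of_odd_countBelow (Nat.lt_succ_iff.1 (Fin.is_lt _)) (fun t ht₁ ht₂ => ?_)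
    fun x => ?_
  · have hcount : countBelow e t = 2 * i + 1 := by
      rw [countBelow, ← ((Tuple.sort (e ∘ ψ)).trans ψ).sum_comp]
      have : ∀ j : Fin (2 * m),
          (if (e (((Tuple.sort (e ∘ ψ)).trans ψ) j) : ℕ) < t then 1 else 0) =
            if (j : ℕ) < 2 * i + 1 then 1 else 0 := by
        intro j
        have h₁ := hlow j
        have h₂ := hhigh j
        simp only [Equiv.trans_apply]
        refine if_congr ⟨fun h => ?_, fun h => ?_⟩ rfl rfl <;> omega
      rw [sum_congr rfl fun j _ => this j, Fin.sum_univ_eq_sum_range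
        (fun j => if j < 2 * i + 1 then 1 else 0), sum_boole, Nat.cast_id]
      have : {j ∈ range (2 * m) | j < 2 * i + 1} = range (2 * i + 1) := by
        ext j
        simp only [mem_filter, mem_range]
        omega
      rw [this, card_range]
    exact ⟨i, hcount⟩
  · obtain ⟨j, rfl⟩ := ((Tuple.sort (e ∘ ψ)).trans ψ).surjective x
    simp only [Equiv.trans_apply]
    rcases le_or_gt (j : ℕ) (2 * i) with h | h
    · exact Or.inl (hlow j h)
    · exact Or.inr (hhigh j h)

theorem card_le_of_sorted_gaps {ι : Type*} [Fintype ι] {m N K : ℕ} (ψ : Fin (2 * m) ≃ ι)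
    (S : Finset (ι → Fin N))
    (hS : ∀ e ∈ S, ∀ (i : ℕ) (hi : i < m),
      (e (ψ (Tuple.sort (e ∘ ψ) ⟨2 * i + 1, by omega⟩)) : ℕ) ≤
        e (ψ (Tuple.sort (e ∘ ψ) ⟨2 * i, by omega⟩)) + K) :
    #S ≤ (2 * m).factorial * (N ^ m * (K + 1) ^ m) := by
  let code : (ι → Fin N) → Equiv.Perm (Fin (2 * m)) × (Fin m → Fin N) × (Fin m → Fin (K + 1)) :=
    fun e => (Tuple.sort (e ∘ ψ), fun i => e (ψ (Tuple.sort (e ∘ ψ) ⟨2 * i, by omega⟩)),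
      fun i => Fin.ofNat (K + 1) (e (ψ (Tuple.sort (e ∘ ψ) ⟨2 * i + 1, by omega⟩)) -
        e (ψ (Tuple.sort (e ∘ ψ) ⟨2 * i, by omega⟩)) : ℕ))
  have hinj : Set.InjOn code S := by
    intro e he e' he' h
    simp only [code, Prod.mk.injEq] at h
    obtain ⟨hσ, hlo, hgap⟩ := h
    have heq : ∀ j, e (ψ (Tuple.sort (e ∘ ψ) j)) = e' (ψ (Tuple.sort (e' ∘ ψ) j)) := by
      intro j
      have hj : (j : ℕ) / 2 < m := by omega
      have h₁ := congrFun hlo ⟨j / 2, hj⟩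
      have h₂ := congrArg Fin.val (congrFun hgap ⟨j / 2, hj⟩)
      simp only [Fin.val_ofNat] at h₂
      have g := hS e he _ hj
      have g' := hS e' he' _ hj
      rw [Nat.mod_eq_of_lt (by omega), Nat.mod_eq_of_lt (by omega)] at h₂
      rcases Nat.even_or_odd' (j : ℕ) with ⟨k, hk | hk⟩
      · have : j = ⟨2 * (j / 2), by omega⟩ := Fin.ext (by simp only; omega)
        rw [this]
        exact h₁
      · have : j = ⟨2 * (j / 2) + 1, by omega⟩ := Fin.ext (by simp only; omega)
        rw [this]
        have m₁ := Tuple.monotone_sort (e ∘ ψ)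
          (a := ⟨2 * (j / 2), by omega⟩) (b := ⟨2 * (j / 2) + 1, by omega⟩)
          (Fin.mk_le_mk.2 (Nat.le_succ _))
        have m₂ := Tuple.monotone_sort (e' ∘ ψ)
          (a := ⟨2 * (j / 2), by omega⟩) (b := ⟨2 * (j / 2) + 1, by omega⟩)
          (Fin.mk_le_mk.2 (Nat.le_succ _))
        simp only [Function.comp_apply, Fin.le_def] at m₁ m₂
        have h₁' := congrArg Fin.val h₁
        simp only at h₁'
        apply Fin.ext
        omega
    funext x
    obtain ⟨j, rfl⟩ := ((Tuple.sort (e ∘ ψ)).trans ψ).surjective x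
    simp only [Equiv.trans_apply]
    rw [heq j, hσ]
  calc #S ≤ #(univ : Finset (Equiv.Perm (Fin (2 * m)) × (Fin m → Fin N) ×
        (Fin m → Fin (K + 1)))) := card_le_card_of_injOn code
        (fun _ _ => mem_coe.2 (mem_univ _)) hinj
    _ = (2 * m).factorial * (N ^ m * (K + 1) ^ m) := by
      simp [Fintype.card_perm, card_univ]

/-- The triples of words of length `n` whose pairwise matchings are listed by `e`. -/
def alignedTriples {n a b c : ℕ} (e : EditIndex a b c → Fin (n + 1)) :
    Set (List Bool × List Bool × List Bool) :=
  {p | (p.1.length = n ∧ p.2.1.length = n ∧ p.2.2.length = n) ∧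
    (NearMatching n a (editRel (e ∘ Sum.inl)) ∧
      ∀ i j, editRel (e ∘ Sum.inl) i j → p.1.getD i false = p.2.1.getD j false) ∧
    (NearMatching n b (editRel (e ∘ Sum.inr ∘ Sum.inl)) ∧
      ∀ i j, editRel (e ∘ Sum.inr ∘ Sum.inl) i j → p.2.1.getD i false = p.2.2.getD j false) ∧
    (NearMatching n c (editRel (e ∘ Sum.inr ∘ Sum.inr)) ∧
      ∀ i j, editRel (e ∘ Sum.inr ∘ Sum.inr) i j → p.2.2.getD i false = p.1.getD j false)}

theorem List.eq_of_getD_eq {n : ℕ} {u v : List Bool} (hu : u.length = n) (hv : v.length = n)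
    (h : ∀ i < n, u.getD i false = v.getD i false) : u = v := by
  refine List.ext_getElem (hu.trans hv.symm) fun i h₁ h₂ => ?_
  have := h i (hu ▸ h₁)
  rwa [List.getD_eq_getElem _ _ h₁, List.getD_eq_getElem _ _ h₂] at this

theorem ncard_alignedTriples_le {n a b c : ℕ} (e : EditIndex a b c → Fin (n + 1)) :
    (alignedTriples e).ncard ≤ 2 ^ (#(fixedPositions e) + 3 * (a + b + c)) := by
  classical
  rcases (alignedTriples e).eq_empty_or_nonempty with h | ⟨-, -, ⟨h₁, -⟩, ⟨h₂, -⟩, ⟨h₃, -⟩⟩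
  · simp [h]
  have hR : NearMatching n (c + a + b) (roundTrip e) := (h₃.comp h₁).comp h₂
  set A : Finset ℕ := fixedPositions e ∪
    ({i ∈ range n | ¬ ∃ j, roundTrip e i j} ∪ {j ∈ range n | ¬ ∃ i, roundTrip e i j})
  set B : Finset ℕ := {j ∈ range n | ¬ ∃ i, editRel (e ∘ Sum.inr ∘ Sum.inr) i j}
  set C : Finset ℕ := {i ∈ range n | ¬ ∃ j, editRel (e ∘ Sum.inr ∘ Sum.inl) i j}
  have hAc : #A ≤ #(fixedPositions e) + ((c + a + b) + (c + a + b)) :=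
    (card_union_le _ _).trans (Nat.add_le_add_left
      ((card_union_le _ _).trans (add_le_add hR.left_miss hR.right_miss)) _)
  have hBc : #B ≤ c := h₃.right_miss
  have hCc : #C ≤ b := h₂.left_miss
  let code : List Bool × List Bool × List Bool → (A → Bool) × (B → Bool) × (C → Bool) :=
    fun p => (fun t => p.2.2.getD t false, fun i => p.1.getD i false, fun j => p.2.1.getD j false)
  have hinj : Set.InjOn code (alignedTriples e) := by
    rintro ⟨u, v, w⟩ ⟨⟨hu, hv, hw⟩, ⟨-, huv⟩, ⟨-, hvw⟩, ⟨-, hwu⟩⟩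
      ⟨u', v', w'⟩ ⟨⟨hu', hv', hw'⟩, ⟨-, huv'⟩, ⟨-, hvw'⟩, ⟨-, hwu'⟩⟩ hcode
    simp only [code, Prod.mk.injEq, funext_iff, Subtype.forall] at hcode huv hvw hwu huv' hvw' hwu'
    obtain ⟨cA, cB, cC⟩ := hcode
    have ew : ∀ i < n, w.getD i false = w'.getD i false := by
      refine hR.eq_of_eq_on ?_ ?_ (fun i hi => cA i ?_) (fun i hi h => cA i ?_)
        (fun i hi h => cA i ?_)
      · rintro i k ⟨j, ⟨l, h, h'⟩, h''⟩
        rw [hwu _ _ h, huv _ _ h', hvw _ _ h'']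
      · rintro i k ⟨j, ⟨l, h, h'⟩, h''⟩
        rw [hwu' _ _ h, huv' _ _ h', hvw' _ _ h'']
      · exact mem_union_left _ (mem_filter.2 ⟨mem_range.2 (hR.left_lt hi), hi⟩)
      · exact mem_union_right _ (mem_union_left _ (mem_filter.2 ⟨mem_range.2 hi, h⟩))
      · exact mem_union_right _ (mem_union_right _ (mem_filter.2 ⟨mem_range.2 hi, h⟩))
    have eu : ∀ i < n, u.getD i false = u'.getD i false := by
      intro i hi
      by_cases h : ∃ t, editRel (e ∘ Sum.inr ∘ Sum.inr) t i
      · obtain ⟨t, ht⟩ := h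
        rw [← hwu _ _ ht, ← hwu' _ _ ht]
        exact ew t ht.1
      · exact cB i (mem_filter.2 ⟨mem_range.2 hi, h⟩)
    have ev : ∀ i < n, v.getD i false = v'.getD i false := by
      intro i hi
      by_cases h : ∃ t, editRel (e ∘ Sum.inr ∘ Sum.inl) i t
      · obtain ⟨t, ht⟩ := h
        rw [hvw _ _ ht, hvw' _ _ ht]
        exact ew t ht.2.1
      · exact cC i (mem_filter.2 ⟨mem_range.2 hi, h⟩)
    exact Prod.ext (List.eq_of_getD_eq hu hu' eu)
      (Prod.ext (List.eq_of_getD_eq hv hv' ev) (List.eq_of_getD_eq hw hw' ew))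
  calc (alignedTriples e).ncard
      ≤ (Set.univ : Set ((A → Bool) × (B → Bool) × (C → Bool))).ncard :=
        Set.ncard_le_ncard_of_injOn code (fun _ _ => Set.mem_univ _) hinj
    _ = 2 ^ (#A + (#B + #C)) := by
        rw [Set.ncard_univ, Nat.card_eq_fintype_card]
        simp [pow_add]
    _ ≤ 2 ^ (#(fixedPositions e) + 3 * (a + b + c)) :=
        Nat.pow_le_pow_right two_pos (by omega)

theorem exists_sum_pow_card_fixedPositions_le (a b c : ℕ) :
    ∃ C : ℝ, 0 < C ∧ ∀ n : ℕ, 1 ≤ n →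
      ∑ e : EditIndex a b c → Fin (n + 1), (2 : ℝ) ^ #(fixedPositions e) ≤
        C * 2 ^ n * (n : ℝ) ^ (a + b + c) := by
  classical
  set m := a + b + c
  obtain ⟨ψ⟩ : Nonempty (Fin (2 * m) ≃ EditIndex a b c) := by
    refine ⟨(Fintype.equivFinOfCardEq ?_).symm⟩
    simp only [Fintype.card_sum, Fintype.card_fin]
    omega
  have hsum : Summable fun L : ℕ => ((L + (2 * m + 2) : ℕ) : ℝ) ^ m * (1 / 2 : ℝ) ^ L := by
    have h₁ : Summable fun L : ℕ => ((L : ℕ) : ℝ) ^ m * (1 / 2 : ℝ) ^ L :=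
      summable_pow_mul_geometric_of_norm_lt_one m (by norm_num)
    have h₂ := ((summable_nat_add_iff (2 * m + 2)).2 h₁).mul_right (2 ^ (2 * m + 2))
    refine h₂.congr fun L => ?_
    rw [pow_add (1 / 2 : ℝ), mul_assoc, mul_assoc, ← mul_pow]
    norm_num
  have hpos : ∀ L : ℕ, 0 ≤ ((L + (2 * m + 2) : ℕ) : ℝ) ^ m * (1 / 2 : ℝ) ^ L := fun L => by
    positivity
  set S := ∑' L : ℕ, ((L + (2 * m + 2) : ℕ) : ℝ) ^ m * (1 / 2 : ℝ) ^ L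
  have hSpos : 0 < S := hsum.tsum_pos hpos 0 (by positivity)
  refine ⟨(2 * m).factorial * 2 ^ m * S, by positivity, fun n hn => ?_⟩
  have hF : ∀ e : EditIndex a b c → Fin (n + 1), #(fixedPositions e) ≤ n := fun e =>
    (card_filter_le _ _).trans (card_range n).le
  have hfib : ∀ L ∈ range (n + 1),
      ∑ e : EditIndex a b c → Fin (n + 1) with n - #(fixedPositions e) = L,
        (2 : ℝ) ^ #(fixedPositions e) ≤
      (2 * m).factorial * 2 ^ m * 2 ^ n * n ^ m *
        (((L + (2 * m + 2) : ℕ) : ℝ) ^ m * (1 / 2 : ℝ) ^ L) := by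
    intro L hL
    rw [mem_range] at hL
    have hterm : ∀ e ∈ (univ : Finset (EditIndex a b c → Fin (n + 1))).filter
        (fun e => n - #(fixedPositions e) = L),
        (2 : ℝ) ^ #(fixedPositions e) = 2 ^ n * (1 / 2 : ℝ) ^ L := by
      intro e he
      have h₁ := (mem_filter.1 he).2
      have h₂ := hF e
      have h₃ : n = #(fixedPositions e) + L := by omega
      have h₄ : (2 : ℝ) ^ n = 2 ^ #(fixedPositions e) * 2 ^ L := by rw [← pow_add, ← h₃]
      rw [h₄, mul_assoc, ← mul_pow]
      norm_num
    rw [sum_congr rfl hterm, sum_const, nsmul_eq_mul]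
    have hcard := card_le_of_sorted_gaps (K := L + 2 * m + 1) ψ
      ((univ : Finset (EditIndex a b c → Fin (n + 1))).filter
        (fun e => n - #(fixedPositions e) = L)) (by
        intro e he i hi
        have := sorted_gap_le ψ e i hi
        rwa [(mem_filter.1 he).2] at this)
    have hcard' : (#((univ : Finset (EditIndex a b c → Fin (n + 1))).filter
        (fun e => n - #(fixedPositions e) = L)) : ℝ) ≤
        (2 * m).factorial * (((n : ℝ) + 1) ^ m * ((L + (2 * m + 2) : ℕ) : ℝ) ^ m) := by
      exact_mod_cast hcard
    have hn' : ((n : ℝ) + 1) ^ m ≤ 2 ^ m * n ^ m := by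
      rw [← mul_pow]
      have : (1 : ℝ) ≤ n := by exact_mod_cast hn
      gcongr
      linarith
    calc _ ≤ ((2 * m).factorial * ((2 ^ m * n ^ m) * ((L + (2 * m + 2) : ℕ) : ℝ) ^ m)) *
          (2 ^ n * (1 / 2 : ℝ) ^ L) := by
          gcongr
          exact hcard'.trans (by gcongr)
      _ = _ := by ring
  calc ∑ e : EditIndex a b c → Fin (n + 1), (2 : ℝ) ^ #(fixedPositions e)
      = ∑ L ∈ range (n + 1), ∑ e : EditIndex a b c → Fin (n + 1) with
          n - #(fixedPositions e) = L, (2 : ℝ) ^ #(fixedPositions e) :=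
        (sum_fiberwise_of_maps_to (fun e _ => mem_range.2 (by omega)) _).symm
    _ ≤ ∑ L ∈ range (n + 1), (2 * m).factorial * 2 ^ m * 2 ^ n * n ^ m *
        (((L + (2 * m + 2) : ℕ) : ℝ) ^ m * (1 / 2 : ℝ) ^ L) := sum_le_sum hfib
    _ ≤ (2 * m).factorial * 2 ^ m * 2 ^ n * n ^ m * S := by
        rw [← mul_sum]
        gcongr
        exact hsum.sum_le_tsum _ fun L _ => hpos L
    _ = _ := by ring

/-- Two words share a subsequence missing at most `a` letters of the first. -/
def HasCommonSublist (a : ℕ) (u v : List Bool) : Prop :=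
  ∃ s : List Bool, s.Sublist u ∧ s.Sublist v ∧ u.length ≤ s.length + a

/-- The triples of words of length `n` within pairwise deletion distances `a`, `b`, `c`. -/
def closeTriples (n a b c : ℕ) : Set (List Bool × List Bool × List Bool) :=
  {p | p.1.length = n ∧ p.2.1.length = n ∧ p.2.2.length = n ∧
    HasCommonSublist a p.1 p.2.1 ∧ HasCommonSublist b p.2.1 p.2.2 ∧ HasCommonSublist c p.2.2 p.1}

theorem finite_closeTriples (n a b c : ℕ) : (closeTriples n a b c).Finite := by
  have h : {l : List Bool | l.length = n}.Finite := List.finite_length_eq Bool n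
  exact (h.prod (h.prod h)).subset fun p hp => ⟨hp.1, hp.2.1, hp.2.2.1⟩

theorem closeTriples_subset (n a b c : ℕ) :
    closeTriples n a b c ⊆ ⋃ e : EditIndex a b c → Fin (n + 1), alignedTriples e := by
  rintro ⟨u, v, w⟩ ⟨hu, hv, hw, ⟨s₁, h₁, h₁', hs₁⟩, ⟨s₂, h₂, h₂', hs₂⟩, ⟨s₃, h₃, h₃', hs₃⟩⟩
  simp only at hu hv hw hs₁ hs₂ hs₃
  obtain ⟨y₁, z₁, hm₁⟩ := exists_alignment hu hv h₁ h₁' (hu ▸ hs₁)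
  obtain ⟨y₂, z₂, hm₂⟩ := exists_alignment hv hw h₂ h₂' (hv ▸ hs₂)
  obtain ⟨y₃, z₃, hm₃⟩ := exists_alignment hw hu h₃ h₃' (hw ▸ hs₃)
  exact Set.mem_iUnion.2 ⟨Sum.elim (Sum.elim y₁ z₁) (Sum.elim (Sum.elim y₂ z₂) (Sum.elim y₃ z₃)),
    ⟨hu, hv, hw⟩, hm₁, hm₂, hm₃⟩

theorem exists_ncard_closeTriples_le (a b c : ℕ) :
    ∃ C : ℝ, 0 < C ∧ ∀ n : ℕ, 1 ≤ n →
      ((closeTriples n a b c).ncard : ℝ) ≤ C * 2 ^ n * (n : ℝ) ^ (a + b + c) := by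
  obtain ⟨C, hC, h⟩ := exists_sum_pow_card_fixedPositions_le a b c
  refine ⟨2 ^ (3 * (a + b + c)) * C, by positivity, fun n hn => ?_⟩
  have hfin : (⋃ e : EditIndex a b c → Fin (n + 1), alignedTriples e).Finite := by
    have h : {l : List Bool | l.length = n}.Finite := List.finite_length_eq Bool n
    refine (h.prod (h.prod h)).subset (Set.iUnion_subset fun e p hp => ?_)
    exact ⟨hp.1.1, hp.1.2.1, hp.1.2.2⟩
  have hnat : (closeTriples n a b c).ncard ≤
      ∑ e : EditIndex a b c → Fin (n + 1), 2 ^ (#(fixedPositions e) + 3 * (a + b + c)) :=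
    (Set.ncard_le_ncard (closeTriples_subset n a b c) hfin).trans
      ((Set.ncard_iUnion_le_of_fintype _).trans
        (sum_le_sum fun e _ => ncard_alignedTriples_le e))
  calc ((closeTriples n a b c).ncard : ℝ)
      ≤ ∑ e : EditIndex a b c → Fin (n + 1), (2 : ℝ) ^ (#(fixedPositions e) + 3 * (a + b + c)) := by
        exact_mod_cast hnat
    _ = 2 ^ (3 * (a + b + c)) *
        ∑ e : EditIndex a b c → Fin (n + 1), (2 : ℝ) ^ #(fixedPositions e) := by
        rw [mul_sum]
        exact sum_congr rfl fun e _ => by rw [pow_add, mul_comm]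
    _ ≤ 2 ^ (3 * (a + b + c)) * (C * 2 ^ n * (n : ℝ) ^ (a + b + c)) := by
        gcongr
        exact h n hn
    _ = _ := by ring

/-- Two subsequences of a word share a long subsequence. -/
theorem exists_common_sublist_of_sublist {w s s' : List Bool} (h : s.Sublist w)
    (h' : s'.Sublist w) :
    ∃ t : List Bool, t.Sublist s ∧ t.Sublist s' ∧ s.length + s'.length ≤ w.length + t.length := by
  induction w generalizing s s' with
  | nil =>
    rw [List.sublist_nil] at h h'
    subst h h'
    exact ⟨[], by simp⟩
  | cons x w ih =>
    rcases List.sublist_cons_iff.1 h with h | ⟨r, rfl, hr⟩ <;>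
      rcases List.sublist_cons_iff.1 h' with h' | ⟨r', rfl, hr'⟩
    · obtain ⟨t, ht, ht', hl⟩ := ih h h'
      exact ⟨t, ht, ht', by rw [List.length_cons]; omega⟩
    · obtain ⟨t, ht, ht', hl⟩ := ih h hr'
      exact ⟨t, ht, ht'.cons x, by simp only [List.length_cons]; omega⟩
    · obtain ⟨t, ht, ht', hl⟩ := ih hr h'
      exact ⟨t, ht.cons x, ht', by simp only [List.length_cons]; omega⟩
    · obtain ⟨t, ht, ht', hl⟩ := ih hr hr'
      exact ⟨x :: t, ht.cons_cons x, ht'.cons_cons x, by simp only [List.length_cons]; omega⟩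

theorem closeTriples_subset_min (n a b c : ℕ) :
    closeTriples n a b c ⊆ closeTriples n (min a (b + c)) b c := by
  rintro ⟨u, v, w⟩ ⟨hu, hv, hw, h₁, ⟨s₂, h₂, h₂', hs₂⟩, ⟨s₃, h₃, h₃', hs₃⟩⟩
  refine ⟨hu, hv, hw, ?_, ⟨s₂, h₂, h₂', hs₂⟩, ⟨s₃, h₃, h₃', hs₃⟩⟩
  rcases min_choice a (b + c) with h | h <;> rw [h]
  · exact h₁
  · obtain ⟨t, ht, ht', hl⟩ := exists_common_sublist_of_sublist h₂' h₃
    refine ⟨t, ht'.trans h₃', ht.trans h₂, ?_⟩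
    simp only at hu hv hw hs₂ hs₃ hl ⊢
    omega

theorem pow_min_le_pow_mul_logb_zpow (a b c n : ℕ) (hn : 2 ≤ n) :
    (n : ℝ) ^ (min a (b + c) + b + c) ≤
      (n : ℝ) ^ (a + b + c) * Real.logb 2 n ^ ((b : ℤ) + (c : ℤ) - (a : ℤ)) := by
  have hn' : (2 : ℝ) ≤ n := by exact_mod_cast hn
  have hlog : 1 ≤ Real.logb 2 n := by
    rw [Real.le_logb_iff_rpow_le one_lt_two (by linarith)]
    simpa using hn'
  have hlogn : Real.logb 2 n ≤ n := by
    rw [Real.logb_le_iff_le_rpow one_lt_two (by linarith), Real.rpow_natCast]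
    exact_mod_cast Nat.lt_two_pow_self.le
  rcases le_total a (b + c) with h | h
  · rw [min_eq_left h]
    exact le_mul_of_one_le_right (by positivity) (one_le_zpow₀ hlog (by omega))
  · obtain ⟨k, rfl⟩ := Nat.exists_eq_add_of_le h
    rw [min_eq_right h, show (b : ℤ) + c - ((b + c + k : ℕ) : ℤ) = -(k : ℤ) by push_cast; ring,
      zpow_neg, zpow_natCast, ← div_eq_mul_inv, le_div_iff₀ (by positivity),
      show b + c + k + b + c = (b + c + b + c) + k by ring, pow_add (n : ℝ) (b + c + b + c) k]
    gcongr

theorem hasCommonSublist_of_delDist_le {a : ℕ} {u v : List Bool} (h : delDist u v ≤ a) :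
    HasCommonSublist a u v := by
  have hmem : LCSlen u v ∈ {m : ℕ | ∃ w : List Bool, w.Sublist u ∧ w.Sublist v ∧ w.length = m} :=
    Nat.sSup_mem ⟨0, [], by simp⟩ ⟨u.length, by
      rintro m ⟨w, hw, -, rfl⟩
      exact hw.length_le⟩
  obtain ⟨s, hu, hv, hs⟩ := hmem
  refine ⟨s, hu, hv, ?_⟩
  rw [delDist] at h
  omega

end

theorem stmt5 (a : ℕ) (ha : 1 ≤ a) :
    ∃ C : ℝ, 0 < C ∧ ∀ b c : ℕ, b ≤ a → c ≤ b → 1 ≤ c → ∀ n : ℕ, 2 ≤ n →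
      (Set.ncard {p : List Bool × List Bool × List Bool |
          p.1.length = n ∧ p.2.1.length = n ∧ p.2.2.length = n ∧
          delDist p.1 p.2.1 ≤ a ∧ delDist p.2.1 p.2.2 ≤ b ∧ delDist p.2.2 p.1 ≤ c} : ℝ)
        ≤ C * 2 ^ n * (n : ℝ) ^ (a + b + c) *
            Real.logb 2 n ^ ((b : ℤ) + (c : ℤ) - (a : ℤ)) := by
  choose C hC hbound using fun b c : ℕ => exists_ncard_closeTriples_le (min a (b + c)) b c
  have hnonneg : ∀ b c, 0 ≤ C b c := fun b c => (hC b c).le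
  refine ⟨∑ b ∈ Finset.range (a + 1), ∑ c ∈ Finset.range (a + 1), C b c,
    Finset.sum_pos (fun b _ => Finset.sum_pos (fun c _ => hC b c) (by simp)) (by simp), ?_⟩
  intro b c hb hc _ n hn
  have hle : C b c ≤ ∑ b ∈ Finset.range (a + 1), ∑ c ∈ Finset.range (a + 1), C b c :=
    (Finset.single_le_sum (fun c _ => hnonneg b c) (Finset.mem_range.2 (by omega))).trans
      (Finset.single_le_sum (f := fun b => ∑ c ∈ Finset.range (a + 1), C b c)
        (fun b _ => Finset.sum_nonneg fun c _ => hnonneg b c) (Finset.mem_range.2 (by omega)))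
  have hsub : {p : List Bool × List Bool × List Bool |
      p.1.length = n ∧ p.2.1.length = n ∧ p.2.2.length = n ∧
      delDist p.1 p.2.1 ≤ a ∧ delDist p.2.1 p.2.2 ≤ b ∧ delDist p.2.2 p.1 ≤ c} ⊆
      closeTriples n (min a (b + c)) b c := by
    rintro p ⟨hu, hv, hw, h₁, h₂, h₃⟩
    exact closeTriples_subset_min n a b c ⟨hu, hv, hw, hasCommonSublist_of_delDist_le h₁,
      hasCommonSublist_of_delDist_le h₂, hasCommonSublist_of_delDist_le h₃⟩
  calc _ ≤ ((closeTriples n (min a (b + c)) b c).ncard : ℝ) :=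
        Nat.cast_le.2 (Set.ncard_le_ncard hsub (finite_closeTriples _ _ _ _))
    _ ≤ C b c * 2 ^ n * (n : ℝ) ^ (min a (b + c) + b + c) := hbound b c n (by omega)
    _ ≤ C b c * 2 ^ n * ((n : ℝ) ^ (a + b + c) *
          Real.logb 2 n ^ ((b : ℤ) + (c : ℤ) - (a : ℤ))) :=
        mul_le_mul_of_nonneg_left (pow_min_le_pow_mul_logb_zpow a b c n hn)
          (mul_nonneg (hnonneg b c) (by positivity))
    _ ≤ _ := by
        rw [← mul_assoc]
        have : 0 ≤ Real.logb 2 n := Real.logb_nonneg one_lt_two (by exact_mod_cast (by omega))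
        gcongr
end

section
/- For every integer k ≥ 1 there exists a constant C > 0 (depending only on k) such that for all integers n ≥ max(k, 2), the number of ordered pairs (u, v) ∈ ({0,1}^n)² with d(u,v) = k and m_SCS(u,v) > 1 is at most C · 2^n · n^(2k−1) · log₂ n. -/
open Set
open scoped List

theorem encard_le_sum_cons {α : Type*} [Fintype α] (S : Set (List α)) (hS : [] ∉ S) :
    S.encard ≤ ∑ x, {p | x :: p ∈ S}.encard := by
  have hsub : S ⊆ ⋃ x, List.cons x '' {p | x :: p ∈ S} := by
    rintro (_ | ⟨x, p⟩) hp
    · exact absurd hp hS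
    · simpa using hp
  exact (encard_le_encard hsub).trans <| (encard_iUnion_le_of_fintype _).trans <|
    Finset.sum_le_sum fun x _ => encard_image_le _ _

/-- The first `m` entries of `p` are all `none`. -/
def GapFree : ℕ → List (Option Bool) → Prop
  | 0, _ => True
  | _ + 1, [] => True
  | m + 1, x :: p => x = none ∧ GapFree m p

/-- Every entry `some _` of `p` is followed by at least `m` entries `none`, or by `none`s only. -/
def Separated (m : ℕ) : List (Option Bool) → Prop
  | [] => True
  | x :: p => (x ≠ none → GapFree m p) ∧ Separated m p

/-- The words of length `N` over `Option Bool` having exactly `j` entries of the form `some _`. -/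
def patterns (N j : ℕ) : Set (List (Option Bool)) :=
  {p | p.length = N ∧ p.countP Option.isSome = j}

theorem encard_patterns_le (N j : ℕ) : (patterns N j).encard ≤ ((2 * N) ^ j : ℕ) := by
  induction N generalizing j with
  | zero =>
    cases j with
    | zero =>
      have : patterns 0 0 ⊆ {[]} := by
        rintro p ⟨hp, -⟩
        exact List.length_eq_zero_iff.1 hp
      simpa using encard_le_encard this
    | succ j =>
      have : patterns 0 (j + 1) = ∅ := by
        ext p
        simp only [patterns, mem_ofPred_eq, List.length_eq_zero_iff, mem_empty_iff_false, iff_false]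
        rintro ⟨rfl, h⟩
        simp at h
      simp [this]
  | succ N ih =>
    refine (encard_le_sum_cons _ (by simp [patterns])).trans ?_
    rw [Fintype.sum_option, Fintype.sum_bool]
    have hnone : {p | none :: p ∈ patterns (N + 1) j} = patterns N j := by
      ext p; simp [patterns]
    cases j with
    | zero =>
      have hsome : ∀ b, {p | some b :: p ∈ patterns (N + 1) 0} = ∅ := by
        intro b; ext p; simp [patterns]
      rw [hnone, hsome, hsome]
      simpa using ih 0
    | succ j =>
      have hsome : ∀ b, {p | some b :: p ∈ patterns (N + 1) (j + 1)} = patterns N j := by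
        intro b; ext p; simp [patterns]
      rw [hnone, hsome, hsome]
      refine (add_le_add (ih (j + 1)) (add_le_add (ih j) (ih j))).trans ?_
      norm_cast
      calc (2 * N) ^ (j + 1) + ((2 * N) ^ j + (2 * N) ^ j) = (2 * (N + 1)) * (2 * N) ^ j := by ring
        _ ≤ (2 * (N + 1)) * (2 * (N + 1)) ^ j := by gcongr; omega
        _ = _ := by ring

theorem encard_patterns_not_gapFree_le (m N j : ℕ) :
    {p ∈ patterns N (j + 1) | ¬ GapFree m p}.encard ≤ (2 * m * (2 * N) ^ j : ℕ) := by
  induction m generalizing N with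
  | zero => simp [GapFree]
  | succ m ih =>
    cases N with
    | zero =>
      have : {p ∈ patterns 0 (j + 1) | ¬ GapFree (m + 1) p} = ∅ := by
        ext p
        simp only [patterns, mem_ofPred_eq, List.length_eq_zero_iff, mem_empty_iff_false, iff_false]
        rintro ⟨⟨rfl, h⟩, -⟩
        simp at h
      simp [this]
    | succ N =>
      refine (encard_le_sum_cons _ (by simp [patterns])).trans ?_
      rw [Fintype.sum_option, Fintype.sum_bool]
      have hnone : {p | none :: p ∈ {p ∈ patterns (N + 1) (j + 1) | ¬ GapFree (m + 1) p}} =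
          {p ∈ patterns N (j + 1) | ¬ GapFree m p} := by
        ext p; simp [patterns, GapFree]
      have hsome : ∀ b, {p | some b :: p ∈ {p ∈ patterns (N + 1) (j + 1) | ¬ GapFree (m + 1) p}} =
          patterns N j := by
        intro b; ext p; simp [patterns, GapFree]
      rw [hnone, hsome, hsome]
      refine (add_le_add (ih N) (add_le_add (encard_patterns_le N j)
        (encard_patterns_le N j))).trans ?_
      norm_cast
      calc 2 * m * (2 * N) ^ j + ((2 * N) ^ j + (2 * N) ^ j) = 2 * (m + 1) * (2 * N) ^ j := by ring
        _ ≤ _ := by gcongr; omega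

theorem encard_patterns_not_separated_le (m N j : ℕ) :
    {p ∈ patterns N (j + 1) | ¬ Separated m p}.encard ≤ (2 * m * j * (2 * N) ^ j : ℕ) := by
  induction N generalizing j with
  | zero =>
    have : {p ∈ patterns 0 (j + 1) | ¬ Separated m p} = ∅ := by
      ext p
      simp only [patterns, mem_ofPred_eq, List.length_eq_zero_iff, mem_empty_iff_false, iff_false]
      rintro ⟨⟨rfl, h⟩, -⟩
      simp at h
    simp [this]
  | succ N ih =>
    refine (encard_le_sum_cons _ (by simp [patterns])).trans ?_
    rw [Fintype.sum_option, Fintype.sum_bool]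
    have hnone : {p | none :: p ∈ {p ∈ patterns (N + 1) (j + 1) | ¬ Separated m p}} =
        {p ∈ patterns N (j + 1) | ¬ Separated m p} := by
      ext p; simp [patterns, Separated]
    have hsome : ∀ b, {p | some b :: p ∈ {p ∈ patterns (N + 1) (j + 1) | ¬ Separated m p}} ⊆
        {p ∈ patterns N j | ¬ GapFree m p} ∪ {p ∈ patterns N j | ¬ Separated m p} := by
      intro b p
      simp [patterns, Separated]
      tauto
    rw [hnone]
    cases j with
    | zero =>
      have hgap : ∀ p ∈ patterns N 0, ∀ m, GapFree m p := by
        rintro p ⟨-, hp⟩ m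
        induction m generalizing p with
        | zero => simp [GapFree]
        | succ m ih =>
          cases p with
          | nil => simp [GapFree]
          | cons x p => cases x <;> simp_all [GapFree]
      have hsep : ∀ p ∈ patterns N 0, Separated m p := by
        rintro p ⟨-, hp⟩
        clear * - hp
        induction p with
        | nil => simp [Separated]
        | cons x p ih => cases x <;> simp_all [Separated]
      have hempty : ∀ b, {p | some b :: p ∈ {p ∈ patterns (N + 1) (0 + 1) | ¬ Separated m p}} =
          ∅ := by
        intro b
        rw [← subset_empty_iff]
        refine (hsome b).trans ?_
        rintro p (⟨h, h'⟩ | ⟨h, h'⟩)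
        · exact h' (hgap p h m)
        · exact h' (hsep p h)
      rw [hempty, hempty]
      simpa using ih 0
    | succ j =>
      have hle : ∀ b, {p | some b :: p ∈ {p ∈ patterns (N + 1) (j + 1 + 1) |
          ¬ Separated m p}}.encard ≤ (2 * m * (2 * N) ^ j + 2 * m * j * (2 * N) ^ j : ℕ) := by
        intro b
        refine (encard_le_encard (hsome b)).trans ((encard_union_le _ _).trans ?_)
        push_cast
        exact_mod_cast add_le_add (encard_patterns_not_gapFree_le m N j) (ih j)
      refine (add_le_add (ih (j + 1)) (add_le_add (hle true) (hle false))).trans ?_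
      norm_cast
      calc _ = 2 * m * (j + 1) * ((2 * (N + 1)) * (2 * N) ^ j) := by ring
        _ ≤ 2 * m * (j + 1) * ((2 * (N + 1)) * (2 * (N + 1)) ^ j) := by gcongr; omega
        _ = _ := by ring

/-- Each of the first `l` letters of `w` agrees with the letter two places later. -/
def PeriodTwo : ℕ → List Bool → Prop
  | 0, _ => True
  | l + 1, a :: b :: c :: w => a = c ∧ PeriodTwo l (b :: c :: w)
  | _ + 1, _ => False

theorem encard_length_eq_le (N : ℕ) : {w : List Bool | w.length = N}.encard ≤ (2 ^ N : ℕ) := by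
  induction N with
  | zero => simp
  | succ N ih =>
    refine (encard_le_sum_cons _ (by simp)).trans ?_
    simp only [Fintype.sum_bool, mem_ofPred_eq, List.length_cons, add_left_inj]
    refine (add_le_add ih ih).trans ?_
    norm_cast
    rw [pow_succ]; omega

theorem encard_periodTwo_mul_le (l N : ℕ) :
    {w : List Bool | w.length = N ∧ PeriodTwo l w}.encard * (2 ^ l : ℕ) ≤ (2 ^ N : ℕ) := by
  induction l generalizing N with
  | zero => simpa [PeriodTwo] using encard_length_eq_le N
  | succ l ih =>
    cases N with
    | zero =>
      have : {w : List Bool | w.length = 0 ∧ PeriodTwo (l + 1) w} = ∅ := by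
        ext w
        simp only [mem_ofPred_eq, List.length_eq_zero_iff, mem_empty_iff_false, iff_false]
        rintro ⟨rfl, h⟩
        simp [PeriodTwo] at h
      rw [this]; simp
    | succ N =>
      have hinj : InjOn List.tail
          {w : List Bool | w.length = N + 1 ∧ PeriodTwo (l + 1) w} := by
        rintro (_ | ⟨a, _ | ⟨b, _ | ⟨c, w⟩⟩⟩) ⟨-, h⟩ (_ | ⟨a', _ | ⟨b', _ | ⟨c', w'⟩⟩⟩) ⟨-, h'⟩ heq <;>
          simp_all [PeriodTwo]
      have hmaps : List.tail '' {w : List Bool | w.length = N + 1 ∧ PeriodTwo (l + 1) w} ⊆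
          {w : List Bool | w.length = N ∧ PeriodTwo l w} := by
        rintro _ ⟨_ | ⟨a, _ | ⟨b, _ | ⟨c, w⟩⟩⟩, ⟨hlen, h⟩, rfl⟩ <;> simp_all [PeriodTwo]
      rw [← hinj.encard_image]
      calc _ ≤ {w : List Bool | w.length = N ∧ PeriodTwo l w}.encard * (2 ^ (l + 1) : ℕ) := by
            gcongr
        _ = {w : List Bool | w.length = N ∧ PeriodTwo l w}.encard * (2 ^ l : ℕ) * 2 := by
            push_cast; ring
        _ ≤ (2 ^ N : ℕ) * 2 := by gcongr; exact ih N
        _ = _ := by push_cast; ring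

/-- Somewhere in `w`, `l` consecutive letters each agree with the letter two places later. -/
def HasPeriodTwo (l : ℕ) (w : List Bool) : Prop := ∃ s, s <:+ w ∧ PeriodTwo l s

theorem HasPeriodTwo.append_left {l : ℕ} {w : List Bool} (h : HasPeriodTwo l w) (x : List Bool) :
    HasPeriodTwo l (x ++ w) :=
  h.imp fun _ hs => ⟨hs.1.trans (List.suffix_append x w), hs.2⟩

theorem HasPeriodTwo.cons {l : ℕ} {w : List Bool} (h : HasPeriodTwo l w) (b : Bool) :
    HasPeriodTwo l (b :: w) := h.append_left [b]

theorem encard_hasPeriodTwo_mul_le {l : ℕ} (hl : 1 ≤ l) (N : ℕ) :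
    {w : List Bool | w.length = N ∧ HasPeriodTwo l w}.encard * (2 ^ l : ℕ) ≤ (N * 2 ^ N : ℕ) := by
  obtain ⟨l, rfl⟩ := Nat.exists_eq_add_of_le' hl
  induction N with
  | zero =>
    have : {w : List Bool | w.length = 0 ∧ HasPeriodTwo (l + 1) w} = ∅ := by
      ext w
      simp only [mem_ofPred_eq, List.length_eq_zero_iff, mem_empty_iff_false, iff_false]
      rintro ⟨rfl, s, hs, h⟩
      rw [List.suffix_nil.1 hs] at h
      simp [PeriodTwo] at h
    rw [this]; simp
  | succ N ih =>
    set A := {w : List Bool | w.length = N ∧ HasPeriodTwo (l + 1) w} with hA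
    set B := {w : List Bool | w.length = N + 1 ∧ PeriodTwo (l + 1) w} with hB
    have hsub : {w : List Bool | w.length = N + 1 ∧ HasPeriodTwo (l + 1) w} ⊆
        B ∪ (List.cons true '' A ∪ List.cons false '' A) := by
      rintro (_ | ⟨b, w⟩) ⟨hlen, s, hs, h⟩
      · simp at hlen
      · rcases List.suffix_cons_iff.1 hs with rfl | hs
        · exact Or.inl ⟨hlen, h⟩
        · have hw : w ∈ A := ⟨by simpa using hlen, s, hs, h⟩
          cases b
          · exact Or.inr (Or.inr ⟨w, hw, rfl⟩)
          · exact Or.inr (Or.inl ⟨w, hw, rfl⟩)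
    have hcard : {w : List Bool | w.length = N + 1 ∧ HasPeriodTwo (l + 1) w}.encard ≤
        B.encard + (A.encard + A.encard) :=
      (encard_le_encard hsub).trans <| (encard_union_le _ _).trans <| by
        gcongr
        exact (encard_union_le _ _).trans (add_le_add (encard_image_le _ _) (encard_image_le _ _))
    calc _ ≤ (B.encard + (A.encard + A.encard)) * (2 ^ (l + 1) : ℕ) := by gcongr
      _ = B.encard * (2 ^ (l + 1) : ℕ) +
          (A.encard * (2 ^ (l + 1) : ℕ) + A.encard * (2 ^ (l + 1) : ℕ)) := by ring
      _ ≤ (2 ^ (N + 1) : ℕ) + ((N * 2 ^ N : ℕ) + (N * 2 ^ N : ℕ)) :=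
        add_le_add (encard_periodTwo_mul_le _ _) (add_le_add ih ih)
      _ = _ := by push_cast; ring

/-- The word read off an alignment by skipping the letters marked `some r`. An alignment is a word
over `Option Bool × Bool`; its mark `none` means that the letter is matched. -/
def proj (r : Bool) (a : List (Option Bool × Bool)) : List Bool :=
  a.filterMap fun s => if s.1 = some r then none else some s.2

/-- The marks of an alignment. -/
abbrev marks (a : List (Option Bool × Bool)) : List (Option Bool) := a.map Prod.fst

/-- The letters of an alignment, that is, the common supersequence it describes. -/
abbrev letters (a : List (Option Bool × Bool)) : List Bool := a.map Prod.snd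

@[simp] theorem proj_nil (r : Bool) : proj r [] = [] := rfl

@[simp] theorem proj_cons_none (r b : Bool) (a : List (Option Bool × Bool)) :
    proj r ((none, b) :: a) = b :: proj r a := by simp [proj]

@[simp] theorem proj_cons_self (r b : Bool) (a : List (Option Bool × Bool)) :
    proj r ((some r, b) :: a) = proj r a := by simp [proj]

@[simp] theorem proj_cons_not (r b : Bool) (a : List (Option Bool × Bool)) :
    proj r ((some !r, b) :: a) = b :: proj r a := by simp [proj]

@[simp] theorem proj_not_cons (r b : Bool) (a : List (Option Bool × Bool)) :
    proj (!r) ((some r, b) :: a) = b :: proj (!r) a := by simp [proj]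

theorem proj_sublist_letters (r : Bool) (a : List (Option Bool × Bool)) :
    proj r a <+ letters a := by
  induction a with
  | nil => simp
  | cons s a ih =>
    obtain ⟨_ | t, b⟩ := s
    · simpa using ih
    · obtain rfl | rfl := Bool.eq_or_eq_not t r
      · simpa using ih.cons b
      · simpa using ih

theorem GapFree.mono {m m' : ℕ} (h : m ≤ m') {p : List (Option Bool)} (hp : GapFree m' p) :
    GapFree m p := by
  induction m' generalizing m p with
  | zero => obtain rfl := Nat.le_zero.1 h; exact hp
  | succ m' ih =>
    cases m with
    | zero => simp [GapFree]
    | succ m =>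
      cases p with
      | nil => simp [GapFree]
      | cons x p => exact ⟨hp.1, ih (by omega) hp.2⟩

/-- A nonempty alignment that starts gap-free starts with a matched letter. -/
theorem exists_eq_cons_of_gapFree {m : ℕ} {a : List (Option Bool × Bool)}
    (ha : GapFree (m + 1) (marks a)) {r c : Bool} {x : List Bool} (h : proj r a = c :: x) :
    ∃ a', a = (none, c) :: a' ∧ proj r a' = x ∧ GapFree m (marks a') := by
  obtain _ | ⟨⟨t, b⟩, a'⟩ := a
  · simp at h
  · obtain ⟨rfl, ha'⟩ : t = none ∧ GapFree m (marks a') := by simpa [GapFree] using ha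
    obtain ⟨rfl, rfl⟩ : b = c ∧ proj r a' = x := by simpa using h
    exact ⟨a', rfl, rfl, ha'⟩

/-- Two gap-free alignments that run on diagonals at distance two force period two. -/
theorem periodTwo_of_gapFree {l : ℕ} {r b c : Bool} {P Q : List (Option Bool × Bool)}
    (hP : GapFree (l + 1) (marks P)) (hQ : GapFree (l + 1) (marks Q))
    (hQP : proj r Q = b :: proj r P) (hPQ : proj (!r) P = c :: proj (!r) Q) :
    PeriodTwo l (b :: letters P) := by
  induction l generalizing b c P Q with
  | zero => simp [PeriodTwo]
  | succ l ih =>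
    obtain ⟨P', rfl, hP', hgP⟩ := exists_eq_cons_of_gapFree hP hPQ
    obtain ⟨Q', rfl, hQ', hgQ⟩ := exists_eq_cons_of_gapFree hQ hQP
    rw [proj_cons_none] at hP' hQ'
    have key := ih hgP hgQ hQ' hP'
    obtain ⟨P'', rfl, -, -⟩ := exists_eq_cons_of_gapFree hgP hP'
    exact ⟨rfl, key⟩

/-- After `P` has skipped a letter `b` that `Q` has matched, either the two alignments meet again,
having read the same letters, or long stretches of period two appear. -/
theorem resync {l m t : ℕ} (hm : l + 1 ≤ m) {r b : Bool} {P Q : List (Option Bool × Bool)}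
    (hP : GapFree (t + (l + 2)) (marks P)) (hsP : Separated m (marks P))
    (hsQ : Separated m (marks Q)) (h : proj r P = proj r Q)
    (h' : proj (!r) P = b :: proj (!r) Q) :
    (∃ x P' Q', letters P = x ++ letters P' ∧ letters Q = x ++ letters Q' ∧
      P'.length < P.length ∧ proj r P' = proj r Q' ∧ proj (!r) P' = proj (!r) Q' ∧
      Separated m (marks P') ∧ Separated m (marks Q')) ∨
    HasPeriodTwo l (letters P) ∨ PeriodTwo t (b :: letters P) := by
  induction t generalizing P Q with
  | zero => simp [PeriodTwo]
  | succ t ih =>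
    obtain ⟨P', rfl, hP', hgP⟩ := exists_eq_cons_of_gapFree
      (hP.mono (show t + (l + 2) + 1 ≤ _ by omega)) h'
    rw [proj_cons_none] at h
    have hsP' : Separated m (marks P') := hsP.2
    obtain _ | ⟨⟨s, c⟩, Q'⟩ := Q
    · simp at h
    have hsQ' : Separated m (marks Q') := hsQ.2
    obtain _ | s := s
    · obtain ⟨rfl, hr⟩ : b = c ∧ proj r P' = proj r Q' := by simpa using h
      rw [proj_cons_none] at hP'
      rcases ih hgP hsP' hsQ' hr hP' with ⟨x, P'', Q'', h1, h2, h3, h4⟩ | hper | hper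
      · refine Or.inl ⟨b :: x, P'', Q'', by simp [h1], by simp [h2], ?_, h4⟩
        simp only [List.length_cons]; omega
      · exact Or.inr (Or.inl (hper.cons b))
      · obtain ⟨P'', rfl, -, -⟩ := exists_eq_cons_of_gapFree
          (hgP.mono (show t + l + 1 + 1 ≤ _ by omega)) hP'
        exact Or.inr (Or.inr ⟨rfl, hper⟩)
    · obtain rfl | rfl := Bool.eq_or_eq_not s r
      · rw [proj_cons_self] at h
        rw [proj_not_cons] at hP'
        refine Or.inr (Or.inl ⟨_, List.suffix_rfl, ?_⟩)
        exact periodTwo_of_gapFree (hgP.mono (by omega)) ((hsQ.1 (by simp)).mono hm) h.symm hP'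
      · obtain ⟨rfl, hr⟩ : b = c ∧ proj r P' = proj r Q' := by simpa using h
        rw [proj_cons_self] at hP'
        exact Or.inl ⟨[b], P', Q', by simp, by simp, by simp, hr, hP', hsP', hsQ'⟩

/-- Two separated alignments of the same pair of words describe the same supersequence, unless one
of these contains a long stretch of period two. -/
theorem letters_eq_or_hasPeriodTwo {l m : ℕ} (hm : 2 * l + 2 ≤ m)
    {P Q : List (Option Bool × Bool)} (hP : Separated m (marks P)) (hQ : Separated m (marks Q))
    (h : ∀ r, proj r P = proj r Q) :
    letters P = letters Q ∨ HasPeriodTwo l (letters P) ∨ HasPeriodTwo l (letters Q) := by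
  induction hN : P.length + Q.length using Nat.strong_induction_on generalizing P Q with
  | _ N ih =>
  have hgap : ∀ {r b : Bool} {P Q : List (Option Bool × Bool)},
      (P.length + 1) + (Q.length + 1) = N → GapFree m (marks P) → Separated m (marks P) →
      Separated m (marks Q) → proj r P = proj r Q → proj (!r) P = b :: proj (!r) Q →
      letters P = letters Q ∨ HasPeriodTwo l (b :: letters P) ∨ HasPeriodTwo l (letters Q) := by
    intro r b P Q hlen hgP hsP hsQ h h'
    rcases resync (l := l) (t := l) (by omega) (hgP.mono (by omega)) hsP hsQ h h' with
      ⟨x, P', Q', hxP, hxQ, hlt, hr, hr', hsP', hsQ'⟩ | hper | hper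
    · have hQlen : Q'.length ≤ Q.length := by
        have := congrArg List.length hxQ
        simp at this
        omega
      have hall : ∀ s, proj s P' = proj s Q' := by
        intro s
        obtain rfl | rfl := Bool.eq_or_eq_not s r <;> assumption
      rcases ih _ (by omega) hsP' hsQ' hall rfl with heq | hper | hper
      · exact Or.inl (by rw [hxP, hxQ, heq])
      · exact Or.inr (Or.inl (by rw [hxP]; exact (hper.append_left x).cons b))
      · exact Or.inr (Or.inr (by rw [hxQ]; exact hper.append_left x))
    · exact Or.inr (Or.inl (hper.cons b))
    · exact Or.inr (Or.inl ⟨_, List.suffix_rfl, hper⟩)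
  have hsame : ∀ {b : Bool} {P Q : List (Option Bool × Bool)},
      (P.length + 1) + (Q.length + 1) = N → Separated m (marks P) → Separated m (marks Q) →
      (∀ r, proj r P = proj r Q) →
      b :: letters P = b :: letters Q ∨ HasPeriodTwo l (b :: letters P) ∨
        HasPeriodTwo l (b :: letters Q) := by
    intro b P Q hlen hsP hsQ h
    rcases ih _ (by omega) hsP hsQ h rfl with heq | hper | hper
    · exact Or.inl (by rw [heq])
    · exact Or.inr (Or.inl (hper.cons b))
    · exact Or.inr (Or.inr (hper.cons b))
  obtain _ | ⟨⟨s, b⟩, P⟩ := P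
  · obtain _ | ⟨⟨s, b⟩, Q⟩ := Q
    · simp
    · obtain _ | s := s
      · simpa using h true
      · simpa using h (!s)
  obtain _ | ⟨⟨t, c⟩, Q⟩ := Q
  · obtain _ | s := s
    · simpa using h true
    · simpa using h (!s)
  have hlen : (P.length + 1) + (Q.length + 1) = N := by simpa using hN
  have hlen' : (Q.length + 1) + (P.length + 1) = N := by omega
  obtain _ | s := s <;> obtain _ | t := t
  · obtain rfl : b = c := by simpa using (List.cons.inj (by simpa using h true)).1
    exact hsame hlen hP.2 hQ.2 fun r => by simpa using h r
  · have h1 := h t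
    have h2 := h (!t)
    rw [proj_cons_none, proj_cons_self] at h1
    rw [proj_cons_none, proj_not_cons] at h2
    obtain ⟨rfl, h3⟩ := List.cons.inj h2
    rcases hgap (r := !t) (b := b) hlen' (hQ.1 (by simp)) hQ.2 hP.2 h3.symm
      (by simpa using h1.symm) with heq | hper | hper
    · exact Or.inl (by simp [heq])
    · exact Or.inr (Or.inr hper)
    · exact Or.inr (Or.inl (hper.cons b))
  · have h1 := h s
    have h2 := h (!s)
    rw [proj_cons_none, proj_cons_self] at h1
    rw [proj_cons_none, proj_not_cons] at h2
    obtain ⟨rfl, h3⟩ := List.cons.inj h2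
    rcases hgap (r := !s) (b := b) hlen (hP.1 (by simp)) hP.2 hQ.2 h3
      (by simpa using h1) with heq | hper | hper
    · exact Or.inl (by simp [heq])
    · exact Or.inr (Or.inl hper)
    · exact Or.inr (Or.inr (hper.cons b))
  · obtain rfl | rfl := Bool.eq_or_eq_not s t
    · have h2 := h (!s)
      rw [proj_not_cons, proj_not_cons] at h2
      obtain ⟨rfl, h3⟩ := List.cons.inj h2
      refine hsame hlen hP.2 hQ.2 fun r => ?_
      obtain rfl | rfl := Bool.eq_or_eq_not r s
      · simpa using h r
      · exact h3
    · have h1 := h t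
      have h2 := h (!t)
      rw [proj_cons_not, proj_cons_self] at h1
      rw [proj_cons_self, proj_not_cons] at h2
      refine Or.inr (Or.inl ⟨_, List.suffix_rfl, ?_⟩)
      exact periodTwo_of_gapFree ((hP.1 (by simp)).mono (by omega))
        ((hQ.1 (by simp)).mono (by omega)) h1.symm h2

theorem exists_alignment_s10 {u v w : List Bool} (hu : u <+ w) (hv : v <+ w) :
    ∃ a, proj true a = u ∧ proj false a = v ∧ letters a <+ w := by
  induction w generalizing u v with
  | nil => exact ⟨[], by simpa [eq_comm] using hu, by simpa [eq_comm] using hv, by simp⟩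
  | cons b w ih =>
    rcases List.sublist_cons_iff.1 hu with hu' | ⟨u', rfl, hu'⟩ <;>
      rcases List.sublist_cons_iff.1 hv with hv' | ⟨v', rfl, hv'⟩ <;>
      obtain ⟨a, rfl, rfl, ha⟩ := ih hu' hv'
    · exact ⟨a, rfl, rfl, ha.cons b⟩
    · exact ⟨(some true, b) :: a, by simp [proj], by simp [proj], by simpa using ha⟩
    · exact ⟨(some false, b) :: a, by simp [proj], by simp [proj], by simpa using ha⟩
    · exact ⟨(none, b) :: a, by simp, by simp, by simpa using ha⟩

theorem length_proj_add_length_proj (a : List (Option Bool × Bool)) :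
    (proj true a).length + (proj false a).length + (marks a).countP Option.isSome =
      2 * a.length := by
  induction a with
  | nil => simp
  | cons s a ih =>
    obtain ⟨_ | _ | _, b⟩ := s <;> simp [proj] at ih ⊢ <;> omega

theorem exists_common_sublist (a : List (Option Bool × Bool)) :
    ∃ z, z <+ proj true a ∧ z <+ proj false a ∧
      z.length + (marks a).countP Option.isSome = a.length := by
  induction a with
  | nil => exact ⟨[], by simp⟩
  | cons s a ih =>
    obtain ⟨z, h1, h2, h3⟩ := ih
    obtain ⟨_ | _ | _, b⟩ := s
    · exact ⟨b :: z, by simpa using h1, by simpa using h2, by simp at h3 ⊢; omega⟩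
    · exact ⟨z, by simpa [proj] using h1.cons b, by simpa [proj] using h2, by simp at h3 ⊢; omega⟩
    · exact ⟨z, by simpa [proj] using h1, by simpa [proj] using h2.cons b, by simp at h3 ⊢; omega⟩

theorem exists_common_supersequence {z u v : List Bool} (hu : z <+ u) (hv : z <+ v) :
    ∃ w, u <+ w ∧ v <+ w ∧ w.length + z.length = u.length + v.length := by
  induction hu generalizing v with
  | slnil => exact ⟨v, by simp⟩
  | cons b _ ih =>
    obtain ⟨w, h1, h2, h3⟩ := ih hv
    exact ⟨b :: w, h1.cons_cons b, h2.cons b, by simp; omega⟩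
  | cons_cons b _ ih =>
    obtain ⟨v₁, v₂, rfl, hb, hv₂⟩ := List.cons_sublist_iff.1 hv
    obtain ⟨w, h1, h2, h3⟩ := ih hv₂
    refine ⟨v₁ ++ w, ?_, List.Sublist.append_left h2 v₁, by simp; omega⟩
    exact (h1.cons_cons b).trans (List.Sublist.append_right (List.singleton_sublist.2 hb) w)

theorem le_LCSlen {z u v : List Bool} (hu : z <+ u) (hv : z <+ v) : z.length ≤ LCSlen u v :=
  le_csSup ⟨u.length, by rintro _ ⟨w, hw, -, rfl⟩; exact hw.length_le⟩ ⟨z, hu, hv, rfl⟩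

theorem exists_length_eq_LCSlen (u v : List Bool) :
    ∃ z, z <+ u ∧ z <+ v ∧ z.length = LCSlen u v :=
  Nat.sSup_mem (s := {m : ℕ | ∃ w : List Bool, w <+ u ∧ w <+ v ∧ w.length = m})
    ⟨0, [], by simp⟩ ⟨u.length, by rintro _ ⟨w, hw, -, rfl⟩; exact hw.length_le⟩

theorem SCSlen_le {w u v : List Bool} (hu : u <+ w) (hv : v <+ w) : SCSlen u v ≤ w.length :=
  Nat.sInf_le ⟨w, hu, hv, rfl⟩

/-- A shortest common supersequence of words of length `n` at deletion distance `k` comes from an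
alignment with `n + k` letters, `2 * k` of them unmatched. -/
theorem exists_alignment_of_shortest {n k : ℕ} {u v w : List Bool} (hun : u.length = n)
    (hvn : v.length = n) (hd : delDist u v = k) (hu : u <+ w) (hv : v <+ w)
    (hw : w.length = SCSlen u v) :
    ∃ a, proj true a = u ∧ proj false a = v ∧ letters a = w ∧
      marks a ∈ patterns (n + k) (2 * k) := by
  obtain ⟨a, rfl, rfl, ha⟩ := exists_alignment_s10 hu hv
  have heq : letters a = w := ha.eq_of_length_le <| by
    rw [hw]
    exact SCSlen_le (proj_sublist_letters _ _) (proj_sublist_letters _ _)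
  refine ⟨a, rfl, rfl, heq, ?_⟩
  subst heq
  have hlen := length_proj_add_length_proj a
  obtain ⟨z, hz1, hz2, hz⟩ := exists_common_sublist a
  have hzle := le_LCSlen hz1 hz2
  obtain ⟨y, hy1, hy2, hy⟩ := exists_length_eq_LCSlen (proj true a) (proj false a)
  obtain ⟨x, hx1, hx2, hx⟩ := exists_common_supersequence hy1 hy2
  have hxle := SCSlen_le hx1 hx2
  rw [delDist] at hd
  simp only [List.length_map] at hw
  constructor
  · rw [List.length_map]; omega
  · omega

theorem encard_alignments_le (A : Set (List (Option Bool))) (B : Set (List Bool)) :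
    {a | marks a ∈ A ∧ letters a ∈ B}.encard ≤ A.encard * B.encard := by
  have hinj : Function.Injective fun a : List (Option Bool × Bool) => (marks a, letters a) := by
    intro a a' h
    obtain ⟨h1, h2⟩ := Prod.mk.inj h
    induction a generalizing a' with
    | nil => simpa using h1.symm
    | cons s a ih =>
      cases a' with
      | nil => simp at h1
      | cons s' a' =>
        simp only [marks, letters, List.map_cons, List.cons.injEq] at h1 h2
        rw [Prod.ext h1.1 h2.1, ih (Prod.ext h1.2 h2.2) h1.2 h2.2]
  rw [← hinj.injOn.encard_image, ← encard_prod]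
  apply encard_le_encard
  rintro _ ⟨a, ⟨h1, h2⟩, rfl⟩
  exact ⟨h1, h2⟩

theorem encard_pairs_le {k n l : ℕ} (hk : 1 ≤ k) :
    {p : List Bool × List Bool |
      p.1.length = n ∧ p.2.length = n ∧ delDist p.1 p.2 = k ∧ 1 < mSCS p.1 p.2}.encard ≤
    (2 * (2 * l + 2) * (2 * k - 1) * (2 * (n + k)) ^ (2 * k - 1) : ℕ) * (2 ^ (n + k) : ℕ) +
      ((2 * (n + k)) ^ (2 * k) : ℕ) *
        {w : List Bool | w.length = n + k ∧ HasPeriodTwo l w}.encard := by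
  set N := n + k with hN
  set A := {p ∈ patterns N (2 * k) | ¬ Separated (2 * l + 2) p}
  set W := {w : List Bool | w.length = N ∧ HasPeriodTwo l w}
  have hsub : {p : List Bool × List Bool |
      p.1.length = n ∧ p.2.length = n ∧ delDist p.1 p.2 = k ∧ 1 < mSCS p.1 p.2} ⊆
      (fun a => (proj true a, proj false a)) ''
        ({a | marks a ∈ A ∧ letters a ∈ {w | w.length = N}} ∪
          {a | marks a ∈ patterns N (2 * k) ∧ letters a ∈ W}) := by
    rintro ⟨u, v⟩ ⟨hu, hv, hd, hm⟩
    obtain ⟨⟨w, ⟨hw1, hw2, hw⟩, w', ⟨hw1', hw2', hw'⟩, hne⟩, -⟩ :=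
      one_lt_ncard_iff_nontrivial_and_finite.1 hm
    obtain ⟨P, hPu, hPv, rfl, hP⟩ := exists_alignment_of_shortest hu hv hd hw1 hw2 hw
    obtain ⟨Q, hQu, hQv, rfl, hQ⟩ := exists_alignment_of_shortest hu hv hd hw1' hw2' hw'
    have hlP : (letters P).length = N := by simpa using hP.1
    have hlQ : (letters Q).length = N := by simpa using hQ.1
    have hPm : (proj true P, proj false P) = (u, v) := by rw [hPu, hPv]
    have hQm : (proj true Q, proj false Q) = (u, v) := by rw [hQu, hQv]
    by_cases hsP : Separated (2 * l + 2) (marks P)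
    · by_cases hsQ : Separated (2 * l + 2) (marks Q)
      · rcases letters_eq_or_hasPeriodTwo le_rfl hsP hsQ
          (Bool.forall_bool.2 ⟨hPv.trans hQv.symm, hPu.trans hQu.symm⟩) with heq | hper | hper
        · exact absurd heq hne
        · exact ⟨P, Or.inr ⟨hP, hlP, hper⟩, hPm⟩
        · exact ⟨Q, Or.inr ⟨hQ, hlQ, hper⟩, hQm⟩
      · exact ⟨Q, Or.inl ⟨⟨hQ, hsQ⟩, hlQ⟩, hQm⟩
    · exact ⟨P, Or.inl ⟨⟨hP, hsP⟩, hlP⟩, hPm⟩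
  refine (encard_le_encard hsub).trans <| (encard_image_le _ _).trans <|
    (encard_union_le _ _).trans <| add_le_add ((encard_alignments_le _ _).trans ?_)
      ((encard_alignments_le _ _).trans ?_)
  · have hA := encard_patterns_not_separated_le (2 * l + 2) N (2 * k - 1)
    rw [show 2 * k - 1 + 1 = 2 * k by omega] at hA
    exact mul_le_mul' hA (encard_length_eq_le N)
  · exact mul_le_mul' (encard_patterns_le N (2 * k)) le_rfl

theorem stmt10 (k : ℕ) (hk : 1 ≤ k) :
    ∃ C : ℝ, 0 < C ∧ ∀ n : ℕ, max k 2 ≤ n →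
      (Set.ncard {p : List Bool × List Bool |
          p.1.length = n ∧ p.2.length = n ∧ delDist p.1 p.2 = k ∧ 1 < mSCS p.1 p.2} : ℝ)
        ≤ C * 2 ^ n * (n : ℝ) ^ (2 * k - 1) * Real.logb 2 n := by
  refine ⟨2 ^ k * 4 ^ (2 * k - 1) * (28 * (2 * k - 1 : ℕ) + 2), by positivity, fun n hn => ?_⟩
  have hkn : k ≤ n := (le_max_left _ _).trans hn
  have hn2 : 2 ≤ n := (le_max_right _ _).trans hn
  set N := n + k with hN
  set l := 2 * (Nat.log 2 N + 1) with hl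
  set W := {w : List Bool | w.length = N ∧ HasPeriodTwo l w}
  have hcard := encard_pairs_le (n := n) (l := l) hk
  have hWfin : W.Finite := (finite_of_encard_le_coe (encard_length_eq_le N)).subset fun w hw => hw.1
  have hW : W.ncard * 2 ^ l ≤ N * 2 ^ N := by
    have := encard_hasPeriodTwo_mul_le (l := l) (by omega) N
    rw [← hWfin.cast_ncard_eq] at this
    exact_mod_cast this
  have hNpos : 0 < N := by omega
  have hWN : N * W.ncard ≤ 2 ^ N := by
    have hpow : N * N ≤ 2 ^ l := by
      have := (Nat.lt_pow_succ_log_self (b := 2) (by norm_num) N).le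
      rw [hl, two_mul, pow_add]
      exact Nat.mul_le_mul this this
    refine Nat.le_of_mul_le_mul_left ?_ hNpos
    calc N * (N * W.ncard) = W.ncard * (N * N) := by ring
      _ ≤ W.ncard * 2 ^ l := by gcongr
      _ ≤ N * 2 ^ N := hW
  have hpairs : Set.ncard {p : List Bool × List Bool |
      p.1.length = n ∧ p.2.length = n ∧ delDist p.1 p.2 = k ∧ 1 < mSCS p.1 p.2} ≤
      2 ^ N * (2 * N) ^ (2 * k - 1) * (2 * (2 * l + 2) * (2 * k - 1) + 2) := by
    rw [← hWfin.cast_ncard_eq] at hcard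
    norm_cast at hcard
    refine (encard_le_coe_iff_finite_ncard_le.1 hcard).2.trans ?_
    have hsplit : (2 * N) ^ (2 * k) = (2 * N) ^ (2 * k - 1) * (2 * N) := by
      rw [← pow_succ]; congr 1; omega
    calc _ = 2 ^ N * (2 * N) ^ (2 * k - 1) * (2 * (2 * l + 2) * (2 * k - 1)) +
          (2 * N) ^ (2 * k - 1) * 2 * (N * W.ncard) := by rw [hsplit]; ring
      _ ≤ 2 ^ N * (2 * N) ^ (2 * k - 1) * (2 * (2 * l + 2) * (2 * k - 1)) +
          (2 * N) ^ (2 * k - 1) * 2 * 2 ^ N := by gcongr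
      _ = _ := by ring
  have hlog : 1 ≤ Real.logb 2 n := by
    rw [Real.le_logb_iff_rpow_le (by norm_num) (by positivity)]
    simpa using (by exact_mod_cast hn2 : (2 : ℝ) ≤ n)
  have hl_le : (2 * l + 2 : ℝ) ≤ 14 * Real.logb 2 n := by
    have h1 : (Nat.log 2 N : ℝ) ≤ Real.logb 2 N := by
      simpa using Real.natLog_le_logb N 2
    have h2 : Real.logb 2 N ≤ 1 + Real.logb 2 n := by
      have : Real.logb 2 (2 * n : ℝ) = 1 + Real.logb 2 n := by
        rw [Real.logb_mul (by norm_num) (by positivity), Real.logb_self_eq_one (by norm_num)]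
      rw [← this]
      refine Real.logb_le_logb_of_le (by norm_num) (by exact_mod_cast hNpos) ?_
      exact_mod_cast (by omega : N ≤ 2 * n)
    rw [hl]
    push_cast
    linarith
  have hbase : (2 * N : ℝ) ≤ 4 * n := by exact_mod_cast (by omega : 2 * N ≤ 4 * n)
  calc _ ≤ ((2 ^ N * (2 * N) ^ (2 * k - 1) * (2 * (2 * l + 2) * (2 * k - 1) + 2) : ℕ) : ℝ) := by
        exact_mod_cast hpairs
    _ = 2 ^ N * (2 * N : ℝ) ^ (2 * k - 1) * (2 * (2 * l + 2) * (2 * k - 1 : ℕ) + 2) := by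
        push_cast; ring
    _ ≤ 2 ^ N * (4 * n : ℝ) ^ (2 * k - 1) *
        (2 * (14 * Real.logb 2 n) * (2 * k - 1 : ℕ) + 2 * Real.logb 2 n) := by
        gcongr
        linarith
    _ = _ := by rw [hN, pow_add, mul_pow]; ring
end
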